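/- arXiv:2402.06338 — 2 statements merged into one kernel-verified Lean document; each statement's English description precedes it below -/
import Mathlib

section
/- For every integer m ≥ 4, every m-fragile finite simple graph G satisfies: for all distinct vertices x, y of G, there exists a proper colouring c of G with colours from {1, …, m} such that c(x) ≠ c(y). -/
/-- A graph is `k`-connected if it has at least `k+1` vertices and deleting any set of
at most `k-1` vertices leaves a connected (in particular nonempty) graph. -/
def SimpleGraph.IsKConnected {V : Type*} (G : SimpleGraph V) (k : ℕ) : Prop :=
  k + 1 ≤ Nat.card V ∧ ∀ S : Set V, S.ncard ≤ k - 1 → (G.induce Sᶜ).Connected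

/-- A graph is fragile if it has no 3-connected subgraph. -/
def SimpleGraph.Fragile {V : Type*} (G : SimpleGraph V) : Prop :=
  ∀ H : G.Subgraph, ¬ H.coe.IsKConnected 3

/-- A graph is `m`-fragile if every 3-connected subgraph of it is `(m-1)`-colourable. -/
def SimpleGraph.MFragile {V : Type*} (m : ℕ) (G : SimpleGraph V) : Prop :=
  ∀ H : G.Subgraph, H.coe.IsKConnected 3 → H.coe.Colorable (m - 1)

namespace SimpleGraph

variable {V : Type*} {m : ℕ}

/-- The map `c` is a proper colouring of the subgraph of `G` induced on `U`. -/
def ProperOn (G : SimpleGraph V) (U : Finset V) (c : V → Fin m) : Prop :=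
  ∀ u ∈ U, ∀ v ∈ U, G.Adj u v → c u ≠ c v

/-- The subgraph of `G` induced on `U` is the union of those induced on the proper subsets `P` and
`Q`, which share exactly the two vertices `s` and `t`. -/
structure TwoSep (G : SimpleGraph V) (U P Q : Finset V) (s t : V) : Prop where
  left_ssubset : P ⊂ U
  right_ssubset : Q ⊂ U
  mem_iff : ∀ v, v ∈ U ↔ v ∈ P ∨ v ∈ Q
  mem_inter : ∀ v, v ∈ P ∧ v ∈ Q ↔ v = s ∨ v = t
  ne : s ≠ t
  not_adj : ∀ u ∈ P, ∀ v ∈ Q, u ∉ Q → v ∉ P → ¬ G.Adj u v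

/-- Exactly two of three values agree. -/
def ExactlyTwoEq {α : Type*} (a b c : α) : Prop :=
  (a = b ∧ a ≠ c) ∨ (a = c ∧ a ≠ b) ∨ (b = c ∧ a ≠ b)

/-- The flexibility of colourings with `m` colours that the main induction propagates. -/
structure Flexible (G : SimpleGraph V) (m : ℕ) (U : Finset V) : Prop where
  exists_eq : ∀ x ∈ U, ∀ y ∈ U, ¬ G.Adj x y → ∃ c : V → Fin m, G.ProperOn U c ∧ c x = c y
  exists_ne : ∀ y ∈ U, ∀ a ∈ U, ∀ b ∈ U, y ≠ a → y ≠ b →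
    ∃ c : V → Fin m, G.ProperOn U c ∧ c y ≠ c a ∧ c y ≠ c b
  exists_two_eq : ∀ x ∈ U, ∀ y ∈ U, ∀ z ∈ U, x ≠ y → x ≠ z → y ≠ z →
    ¬ G.Adj x y → ¬ G.Adj x z → ¬ G.Adj y z →
    ∃ c : V → Fin m, G.ProperOn U c ∧ ExactlyTwoEq (c x) (c y) (c z)

variable {G : SimpleGraph V} {U P Q : Finset V} {s t : V}

lemma exists_color_ne (hm : 4 ≤ m) (p q r : Fin m) : ∃ k : Fin m, k ≠ p ∧ k ≠ q ∧ k ≠ r := by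
  have h : ({p, q, r} : Finset (Fin m)).card < Fintype.card (Fin m) := by
    have := Finset.card_le_three (a := p) (b := q) (c := r)
    simp only [Fintype.card_fin]
    omega
  obtain ⟨k, hk⟩ := Finset.exists_mem_notMem_of_card_lt_card (t := Finset.univ) h
  exact ⟨k, by simpa using hk⟩

lemma TwoSep.symm (h : G.TwoSep U P Q s t) : G.TwoSep U Q P s t where
  left_ssubset := h.right_ssubset
  right_ssubset := h.left_ssubset
  mem_iff v := by rw [h.mem_iff, or_comm]
  mem_inter v := by rw [and_comm, h.mem_inter]
  ne := h.ne
  not_adj u hu v hv h1 h2 ha := h.not_adj v hv u hu h2 h1 ha.symm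

lemma TwoSep.mem (h : G.TwoSep U P Q s t) : s ∈ P ∧ t ∈ P ∧ s ∈ Q ∧ t ∈ Q :=
  ⟨((h.mem_inter s).2 (.inl rfl)).1, ((h.mem_inter t).2 (.inr rfl)).1,
    ((h.mem_inter s).2 (.inl rfl)).2, ((h.mem_inter t).2 (.inr rfl)).2⟩

/-- Two triples with the same equality pattern are related by a permutation. -/
lemma exists_perm_triple {p q r p' q' r' : Fin m} (h1 : p = q ↔ p' = q') (h2 : p = r ↔ p' = r')
    (h3 : q = r ↔ q' = r') : ∃ σ : Equiv.Perm (Fin m), σ p = p' ∧ σ q = q' ∧ σ r = r' := by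
  set σ₁ := Equiv.swap p p' with hσ₁
  set σ₂ := Equiv.swap (σ₁ q) q' with hσ₂
  set σ₃ := Equiv.swap (σ₂ (σ₁ r)) r' with hσ₃
  refine ⟨(σ₁.trans σ₂).trans σ₃, ?_, ?_, ?_⟩ <;>
  simp only [Equiv.trans_apply, hσ₁, hσ₂, hσ₃, Equiv.swap_apply_def] <;> grind

/-- Colourings of the two sides glue when they agree on the shared vertices up to renaming
colours; moreover the colour `k` of one further vertex `a` can be prescribed. -/
lemma TwoSep.glue (h : G.TwoSep U P Q s t) {c d : V → Fin m} (hc : G.ProperOn P c)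
    (hd : G.ProperOn Q d) (a : V) (k : Fin m) (hst : d s = d t ↔ c s = c t)
    (hs : d a = d s ↔ k = c s) (ht : d a = d t ↔ k = c t) :
    ∃ e : V → Fin m, G.ProperOn U e ∧ (∀ v ∈ P, e v = c v) ∧ (a ∉ P → e a = k) := by
  classical
  obtain ⟨σ, h1, h2, h3⟩ := exists_perm_triple hs ht hst
  have hQ : ∀ v ∈ P, v ∈ Q → c v = σ (d v) := by
    intro v hv hv'
    rcases (h.mem_inter v).1 ⟨hv, hv'⟩ with rfl | rfl
    · exact h2.symm
    · exact h3.symm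
  refine ⟨fun v => if v ∈ P then c v else σ (d v), ?_, fun v hv => if_pos hv, fun hv => ?_⟩
  · have hQ' : ∀ v ∈ Q, (if v ∈ P then c v else σ (d v)) = σ (d v) := by
      intro v hv
      split_ifs with hv'
      · exact hQ v hv' hv
      · rfl
    intro u hu v hv huv
    by_cases huP : u ∈ P <;> by_cases hvP : v ∈ P
    · simpa [huP, hvP] using hc u huP v hvP huv
    all_goals
      have := h.not_adj
      have := huv.symm
      have huQ : u ∈ Q := by have := h.mem_iff; grind
      have hvQ : v ∈ Q := by have := h.mem_iff; grind
      simp only [hQ' u huQ, hQ' v hvQ]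
      exact fun he => hd u huQ v hvQ huv (σ.injective he)
  · simp only [if_neg hv, h1]

lemma Flexible.exists_ne' (h : Flexible G m U) {x y : V} (hx : x ∈ U) (hy : y ∈ U) (hxy : x ≠ y) :
    ∃ c : V → Fin m, G.ProperOn U c ∧ c x ≠ c y := by
  obtain ⟨c, hc, h1, -⟩ := h.exists_ne x hx y hy y hy hxy hxy
  exact ⟨c, hc, h1⟩

lemma Flexible.exists_eq_iff (h : Flexible G m U) {x y : V} (hx : x ∈ U) (hy : y ∈ U)
    (hxy : x ≠ y) (p : Prop) (hp : p → ¬ G.Adj x y) :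
    ∃ c : V → Fin m, G.ProperOn U c ∧ (c x = c y ↔ p) := by
  by_cases hp' : p
  · obtain ⟨c, hc, h1⟩ := h.exists_eq x hx y hy (hp hp')
    exact ⟨c, hc, by simp [h1, hp']⟩
  · obtain ⟨c, hc, h1⟩ := h.exists_ne' hx hy hxy
    exact ⟨c, hc, by simp [h1, hp']⟩

lemma TwoSep.extend (h : G.TwoSep U P Q s t) (hQ : Flexible G m Q) {c : V → Fin m}
    (hc : G.ProperOn P c) : ∃ e : V → Fin m, G.ProperOn U e ∧ ∀ v ∈ P, e v = c v := by
  obtain ⟨hsP, htP, hsQ, htQ⟩ := h.mem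
  obtain ⟨d, hd, hst⟩ := hQ.exists_eq_iff hsQ htQ h.ne (c s = c t)
    fun he ha => hc s hsP t htP ha he
  obtain ⟨e, he, h1, -⟩ := h.glue hc hd s (c s) hst (by simp) hst
  exact ⟨e, he, h1⟩

/-- A colouring that avoids the colour `k` leaves room for recolouring an independent set. -/
lemma flexible_of_avoids {c : V → Fin m} (hc : G.ProperOn U c) (k : Fin m) (hk : ∀ v, c v ≠ k) :
    Flexible G m U := by
  classical
  have key : ∀ W : Finset V, (∀ u ∈ W, ∀ v ∈ W, ¬ G.Adj u v) →
      G.ProperOn U fun v => if v ∈ W then k else c v := by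
    intro W hW u hu v hv huv
    have := hc u hu v hv huv
    have := hk u
    have := hk v
    have := hW u
    dsimp only
    grind
  refine ⟨fun x _ y _ hxy => ?_, fun y _ a _ b _ hya hyb => ?_,
    fun x _ y _ z _ hxy hxz hyz h1 h2 h3 => ?_⟩
  · refine ⟨_, key {x, y} ?_, by simp⟩
    simp [hxy, G.adj_comm y x]
  · refine ⟨_, key {y} (by simp), ?_⟩
    simp [hya.symm, hyb.symm, (hk _).symm]
  · by_cases hxy' : c x = c y
    · by_cases hxz' : c x = c z
      · refine ⟨_, key {x} (by simp), ?_⟩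
        right; right
        simp [hxy.symm, hxz.symm, ← hxy', ← hxz', (hk _).symm]
      · exact ⟨c, hc, .inl ⟨hxy', hxz'⟩⟩
    · refine ⟨_, key {x, y} ?_, ?_⟩
      · simp [h1, G.adj_comm y x]
      · left
        simp [hxz.symm, hyz.symm, (hk _).symm]

/-- The colourings of `U` realise one of four families of equality patterns on `a`, `s`, `t`. -/
lemma Flexible.patterns (h : Flexible G m U) {a : V} (ha : a ∈ U) (hs : s ∈ U) (ht : t ∈ U)
    (has : a ≠ s) (hat : a ≠ t) (hst : s ≠ t) (hadj : ¬ G.Adj s t) :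
    ((∃ c : V → Fin m, G.ProperOn U c ∧ c s = c t ∧ c a ≠ c s) ∧
      ((∃ c : V → Fin m, G.ProperOn U c ∧ c s ≠ c t ∧ c a ≠ c s ∧ c a ≠ c t) ∨
        (∃ c : V → Fin m, G.ProperOn U c ∧ c s ≠ c t ∧ c a = c s) ∧
        ∃ c : V → Fin m, G.ProperOn U c ∧ c s ≠ c t ∧ c a = c t)) ∨
    ((∃ c : V → Fin m, G.ProperOn U c ∧ c s = c t ∧ c a = c s) ∧
      (∃ c : V → Fin m, G.ProperOn U c ∧ c s ≠ c t ∧ c a ≠ c s ∧ c a ≠ c t) ∧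
      ((∃ c : V → Fin m, G.ProperOn U c ∧ c s ≠ c t ∧ c a = c s) ∨
        ∃ c : V → Fin m, G.ProperOn U c ∧ c s ≠ c t ∧ c a = c t)) := by
  obtain ⟨c₁, hc₁, h₁⟩ := h.exists_eq s hs t ht hadj
  obtain ⟨c₂, hc₂, h₂, h₂'⟩ := h.exists_ne a ha s hs t ht has hat
  obtain ⟨c₃, hc₃, h₃, h₃'⟩ := h.exists_ne s hs a ha t ht has.symm hst
  obtain ⟨c₄, hc₄, h₄, h₄'⟩ := h.exists_ne t ht a ha s hs hat.symm hst.symm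
  by_cases hr : ∃ c : V → Fin m, G.ProperOn U c ∧ c s ≠ c t ∧ c a ≠ c s ∧ c a ≠ c t
  · by_cases h5 : c₁ a = c₁ s
    · obtain ⟨c, hc, h6⟩ := h.exists_two_eq a ha s hs t ht has hat hst
        (fun h => hc₁ a ha s hs h h5) (fun h => hc₁ a ha t ht h (h5.trans h₁)) hadj
      rcases h6 with ⟨h6, h7⟩ | ⟨h6, h7⟩ | ⟨h6, h7⟩
      · exact .inr ⟨⟨c₁, hc₁, h₁, h5⟩, hr, .inl ⟨c, hc, h6 ▸ h7, h6⟩⟩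
      · exact .inr ⟨⟨c₁, hc₁, h₁, h5⟩, hr, .inr ⟨c, hc, fun h => h7 (h6.trans h.symm), h6⟩⟩
      · exact .inl ⟨⟨c, hc, h6, h7⟩, .inl hr⟩
    · exact .inl ⟨⟨c₁, hc₁, h₁, h5⟩, .inl hr⟩
  · push Not at hr
    refine .inl ⟨⟨c₂, hc₂, ?_, h₂⟩, .inr ⟨⟨c₄, hc₄, h₄'.symm, ?_⟩, ⟨c₃, hc₃, h₃', ?_⟩⟩⟩
    · exact by_contra fun h => h₂' (hr c₂ hc₂ h h₂)
    · exact by_contra fun h => h₄.symm (hr c₄ hc₄ h₄'.symm h)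
    · exact hr c₃ hc₃ h₃' h₃.symm

/-- If the two sides are flexible, two nonadjacent vertices on different sides can share a
colour. -/
lemma TwoSep.exists_eq (h : G.TwoSep U P Q s t) (hP : Flexible G m P) (hQ : Flexible G m Q)
    {x y : V} (hx : x ∈ P) (hx' : x ∉ Q) (hy : y ∈ Q) (hy' : y ∉ P) :
    ∃ c : V → Fin m, G.ProperOn U c ∧ c x = c y := by
  obtain ⟨hsP, htP, hsQ, htQ⟩ := h.mem
  have hxs : x ≠ s := fun h => hx' (h ▸ hsQ)
  have hxt : x ≠ t := fun h => hx' (h ▸ htQ)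
  have hys : y ≠ s := fun h => hy' (h ▸ hsP)
  have hyt : y ≠ t := fun h => hy' (h ▸ htP)
  obtain ⟨c, d, hc, hd, h1, h2, h3⟩ : ∃ c d : V → Fin m, G.ProperOn P c ∧ G.ProperOn Q d ∧
      (d s = d t ↔ c s = c t) ∧ (d y = d s ↔ c x = c s) ∧ (d y = d t ↔ c x = c t) := by
    by_cases hst : G.Adj s t
    · obtain ⟨c, hc, h1, h2⟩ := hP.exists_ne x hx s hsP t htP hxs hxt
      obtain ⟨d, hd, h3, h4⟩ := hQ.exists_ne y hy s hsQ t htQ hys hyt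
      exact ⟨c, d, hc, hd, by simp [hc s hsP t htP hst, hd s hsQ t htQ hst], by simp [h1, h3],
        by simp [h2, h4]⟩
    · have h1 := hP.patterns hx hsP htP hxs hxt h.ne hst
      have h2 := hQ.patterns hy hsQ htQ hys hyt h.ne hst
      grind
  obtain ⟨e, he, h4, h5⟩ := h.glue hc hd y (c x) h1 h2 h3
  exact ⟨e, he, by rw [h4 x hx, h5 hy']⟩

lemma TwoSep.exists_two_eq (hm : 4 ≤ m) (h : G.TwoSep U P Q s t) (hP : Flexible G m P)
    (hQ : Flexible G m Q) {x y z : V} (hx : x ∈ Q) (hx' : x ∉ P) (hy : y ∈ P) (hz : z ∈ P)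
    (hyz : ¬ G.Adj y z) :
    ∃ c : V → Fin m, G.ProperOn U c ∧ ExactlyTwoEq (c x) (c y) (c z) := by
  obtain ⟨hsP, htP, hsQ, htQ⟩ := h.mem
  have hxs : x ≠ s := fun h => hx' (h ▸ hsP)
  have hxt : x ≠ t := fun h => hx' (h ▸ htP)
  suffices ∃ c d : V → Fin m, G.ProperOn P c ∧ G.ProperOn Q d ∧ ∃ k,
      (d s = d t ↔ c s = c t) ∧ (d x = d s ↔ k = c s) ∧ (d x = d t ↔ k = c t) ∧
      ExactlyTwoEq k (c y) (c z) by
    obtain ⟨c, d, hc, hd, k, h1, h2, h3, h4⟩ := this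
    obtain ⟨e, he, h5, h6⟩ := h.glue hc hd x k h1 h2 h3
    exact ⟨e, he, by rwa [h5 y hy, h5 z hz, h6 hx']⟩
  unfold ExactlyTwoEq
  obtain ⟨c, hc, h1⟩ := hP.exists_eq y hy z hz hyz
  obtain ⟨k, hk⟩ := exists_color_ne hm (c s) (c t) (c y)
  by_cases hst : G.Adj s t
  · obtain ⟨d, hd, h2, h3⟩ := hQ.exists_ne x hx s hsQ t htQ hxs hxt
    exact ⟨c, d, hc, hd, k, by simp [hc s hsP t htP hst, hd s hsQ t htQ hst], by grind⟩
  · rcases hQ.patterns hx hsQ htQ hxs hxt h.ne hst with ⟨h2, h3⟩ | ⟨⟨d, hd, h2⟩, ⟨d', hd', h3⟩, h4⟩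
    · by_cases h5 : c s = c t
      · obtain ⟨d, hd, h6⟩ := h2
        exact ⟨c, d, hc, hd, k, by grind⟩
      · rcases h3 with ⟨d, hd, h6⟩ | ⟨⟨d, hd, h6⟩, ⟨d', hd', h6'⟩⟩
        · exact ⟨c, d, hc, hd, k, by grind⟩
        · by_cases h7 : c s = c y
          · exact ⟨c, d', hc, hd', c t, by grind⟩
          · exact ⟨c, d, hc, hd, c s, by grind⟩
    · obtain ⟨c, hc, h5⟩ := hP.exists_ne' hsP htP h.ne
      obtain ⟨k, hk⟩ := exists_color_ne hm (c s) (c t) (c y)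
      by_cases h6 : c y = c z
      · exact ⟨c, d', hc, hd', k, by grind⟩
      rcases h4 with ⟨d₁, hd₁, h7⟩ | ⟨d₁, hd₁, h7⟩
      · by_cases h8 : c s = c y ∨ c s = c z
        · exact ⟨c, d₁, hc, hd₁, c s, by grind⟩
        · by_cases h9 : c y = c t
          · exact ⟨c, d', hc, hd', c z, by grind⟩
          · exact ⟨c, d', hc, hd', c y, by grind⟩
      · by_cases h8 : c t = c y ∨ c t = c z
        · exact ⟨c, d₁, hc, hd₁, c t, by grind⟩
        · by_cases h9 : c y = c s
          · exact ⟨c, d', hc, hd', c z, by grind⟩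
          · exact ⟨c, d', hc, hd', c y, by grind⟩

lemma TwoSep.exists_ne_of_right (hm : 4 ≤ m) (h : G.TwoSep U P Q s t) (hP : Flexible G m P)
    (hQ : Flexible G m Q) {y a b : V} (ha : a ∈ Q) (ha' : a ∉ P) (hy : y ∈ P) (hb : b ∈ P)
    (hyb : y ≠ b) :
    ∃ c : V → Fin m, G.ProperOn U c ∧ c y ≠ c a ∧ c y ≠ c b := by
  obtain ⟨hsP, htP, hsQ, htQ⟩ := h.mem
  have has : a ≠ s := fun h => ha' (h ▸ hsP)
  have hat : a ≠ t := fun h => ha' (h ▸ htP)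
  suffices ∃ c d : V → Fin m, G.ProperOn P c ∧ G.ProperOn Q d ∧ ∃ k,
      (d s = d t ↔ c s = c t) ∧ (d a = d s ↔ k = c s) ∧ (d a = d t ↔ k = c t) ∧
      c y ≠ k ∧ c y ≠ c b by
    obtain ⟨c, d, hc, hd, k, h1, h2, h3, h4⟩ := this
    obtain ⟨e, he, h5, h6⟩ := h.glue hc hd a k h1 h2 h3
    exact ⟨e, he, by rwa [h5 y hy, h5 b hb, h6 ha']⟩
  obtain ⟨c, hc, h1⟩ := hP.exists_ne' hy hb hyb
  obtain ⟨k, hk⟩ := exists_color_ne hm (c s) (c t) (c y)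
  by_cases hst : G.Adj s t
  · obtain ⟨d, hd, h2, h3⟩ := hQ.exists_ne a ha s hsQ t htQ has hat
    exact ⟨c, d, hc, hd, k, by simp [hc s hsP t htP hst, hd s hsQ t htQ hst], by grind⟩
  · rcases hQ.patterns ha hsQ htQ has hat h.ne hst with ⟨h2, h3⟩ | ⟨⟨d, hd, h2⟩, ⟨d', hd', h3⟩, -⟩
    · by_cases h5 : c s = c t
      · obtain ⟨d, hd, h6⟩ := h2
        exact ⟨c, d, hc, hd, k, by grind⟩
      · rcases h3 with ⟨d, hd, h6⟩ | ⟨⟨d, hd, h6⟩, ⟨d', hd', h6'⟩⟩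
        · exact ⟨c, d, hc, hd, k, by grind⟩
        · by_cases h7 : c s = c y
          · exact ⟨c, d', hc, hd', c t, by grind⟩
          · exact ⟨c, d, hc, hd, c s, by grind⟩
    · obtain ⟨c, hc, h5, h6⟩ : ∃ c : V → Fin m, G.ProperOn P c ∧ c y ≠ c b ∧
          (c s = c t → c y ≠ c s) := by
        by_cases hys : y = s
        · subst hys
          obtain ⟨c, hc, h5, h6⟩ := hP.exists_ne y hy b hb t htP hyb h.ne
          exact ⟨c, hc, h5, fun h => absurd h h6⟩
        · obtain ⟨c, hc, h5, h6⟩ := hP.exists_ne y hy b hb s hsP hyb hys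
          exact ⟨c, hc, h5, fun _ => h6⟩
      obtain ⟨k, hk⟩ := exists_color_ne hm (c s) (c t) (c y)
      by_cases h7 : c s = c t
      · exact ⟨c, d, hc, hd, c s, by grind⟩
      · exact ⟨c, d', hc, hd', k, by grind⟩

/-- A vertex on the right can avoid two vertices on the left, provided some colouring of the left
side does not give those two and the shared vertices four different colours. -/
lemma TwoSep.exists_ne_of_left (hm : 4 ≤ m) (h : G.TwoSep U P Q s t) (hP : Flexible G m P)
    (hQ : Flexible G m Q) {y a b : V} (hy : y ∈ Q) (hy' : y ∉ P) (ha : a ∈ P) (hb : b ∈ P)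
    (hK : G.Adj a s → G.Adj a t → G.Adj b s → G.Adj b t → G.Adj s t → G.Adj a b → 5 ≤ m) :
    ∃ c : V → Fin m, G.ProperOn U c ∧ c y ≠ c a ∧ c y ≠ c b := by
  obtain ⟨hsP, htP, hsQ, htQ⟩ := h.mem
  have hys : y ≠ s := fun h => hy' (h ▸ hsP)
  have hyt : y ≠ t := fun h => hy' (h ▸ htP)
  have finish : (∃ c d : V → Fin m, G.ProperOn P c ∧ G.ProperOn Q d ∧ ∃ k,
      (d s = d t ↔ c s = c t) ∧ (d y = d s ↔ k = c s) ∧ (d y = d t ↔ k = c t) ∧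
      k ≠ c a ∧ k ≠ c b) → ∃ c : V → Fin m, G.ProperOn U c ∧ c y ≠ c a ∧ c y ≠ c b := by
    rintro ⟨c, d, hc, hd, k, h1, h2, h3, h4⟩
    obtain ⟨e, he, h5, h6⟩ := h.glue hc hd y k h1 h2 h3
    exact ⟨e, he, by rwa [h5 a ha, h5 b hb, h6 hy']⟩
  apply finish
  by_cases hcut : (a = s ∨ a = t) ∨ b = s ∨ b = t
  · obtain ⟨d, hd, h1, h2⟩ := hQ.exists_ne y hy s hsQ t htQ hys hyt
    obtain ⟨c, hc, h3⟩ := hP.exists_eq_iff hsP htP h.ne (d s = d t)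
      fun h4 h5 => hd s hsQ t htQ h5 h4
    obtain ⟨ka, hka⟩ := exists_color_ne hm (c s) (c t) (c a)
    obtain ⟨kb, hkb⟩ := exists_color_ne hm (c s) (c t) (c b)
    rcases hcut with hcut | hcut
    · exact ⟨c, d, hc, hd, kb, by grind⟩
    · exact ⟨c, d, hc, hd, ka, by grind⟩
  push Not at hcut
  obtain ⟨⟨has, hat⟩, hbs, hbt⟩ := hcut
  by_cases hst : G.Adj s t
  · obtain ⟨d, hd, h1, h2⟩ := hQ.exists_ne y hy s hsQ t htQ hys hyt
    have hds := hd s hsQ t htQ hst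
    obtain ⟨c, k, hc, hk⟩ : ∃ c : V → Fin m, ∃ k, G.ProperOn P c ∧
        k ≠ c s ∧ k ≠ c t ∧ k ≠ c a ∧ k ≠ c b := by
      by_cases h3 : ∃ c : V → Fin m, G.ProperOn P c ∧
          (c a = c s ∨ c a = c t ∨ c b = c s ∨ c b = c t ∨ c a = c b)
      · obtain ⟨c, hc, h3⟩ := h3
        obtain ⟨k, hk⟩ := exists_color_ne hm (c s) (c t) (c a)
        obtain ⟨l, hl⟩ := exists_color_ne hm (c s) (c t) (c b)
        by_cases h4 : k = c b
        · exact ⟨c, l, hc, by grind⟩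
        · exact ⟨c, k, hc, by grind⟩
      · have key : ∀ u ∈ P, ∀ v ∈ P, (∀ c : V → Fin m, c u = c v →
            c a = c s ∨ c a = c t ∨ c b = c s ∨ c b = c t ∨ c a = c b) → G.Adj u v := by
          intro u hu v hv h4
          by_contra h5
          obtain ⟨c, hc, h6⟩ := hP.exists_eq u hu v hv h5
          exact h3 ⟨c, hc, h4 c h6⟩
        have hm5 : 5 ≤ m := hK (key a ha s hsP (by grind)) (key a ha t htP (by grind))
          (key b hb s hsP (by grind)) (key b hb t htP (by grind)) hst (key a ha b hb (by grind))
        obtain ⟨c, hc, -⟩ := hP.exists_ne' hsP htP h.ne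
        have h4 : ({c s, c t, c a, c b} : Finset (Fin m)).card < Fintype.card (Fin m) := by
          have := Finset.card_le_four (a := c s) (b := c t) (c := c a) (d := c b)
          simp only [Fintype.card_fin]
          omega
        obtain ⟨k, hk⟩ := Finset.exists_mem_notMem_of_card_lt_card (t := Finset.univ) h4
        exact ⟨c, k, hc, by simpa using hk⟩
    have hcs := hc s hsP t htP hst
    exact ⟨c, d, hc, hd, k, by grind⟩
  · rcases hQ.patterns hy hsQ htQ hys hyt h.ne hst with ⟨⟨d, hd, h1⟩, -⟩ | ⟨⟨d, hd, h1⟩, -, h2⟩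
    · obtain ⟨c, hc, h2⟩ := hP.exists_eq s hsP t htP hst
      obtain ⟨k, hk⟩ := exists_color_ne hm (c s) (c a) (c b)
      exact ⟨c, d, hc, hd, k, by grind⟩
    · rcases h2 with ⟨d', hd', h3⟩ | ⟨d', hd', h3⟩
      · obtain ⟨c, hc, h4⟩ := hP.exists_ne s hsP a ha b hb has.symm hbs.symm
        by_cases h5 : c s = c t
        · exact ⟨c, d, hc, hd, c s, by grind⟩
        · exact ⟨c, d', hc, hd', c s, by grind⟩
      · obtain ⟨c, hc, h4⟩ := hP.exists_ne t htP a ha b hb hat.symm hbt.symm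
        by_cases h5 : c s = c t
        · exact ⟨c, d, hc, hd, c t, by grind⟩
        · exact ⟨c, d', hc, hd', c t, by grind⟩

/-- If every induced subgraph has a colouring avoiding the colour `k` or a separation of order two,
then every induced subgraph is flexible. -/
lemma flexible_of_dichotomy (hm : 4 ≤ m) (k : Fin m)
    (hdich : ∀ U : Finset V, (∃ c : V → Fin m, G.ProperOn U c ∧ ∀ v, c v ≠ k) ∨
      ∃ P Q s t, G.TwoSep U P Q s t) (U : Finset V) : Flexible G m U := by
  classical
  induction U using Finset.strongInduction with
  | H U ih =>
  rcases hdich U with ⟨c, hc, hk⟩ | ⟨P, Q, s, t, h⟩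
  · exact flexible_of_avoids hc k hk
  have hP := ih P h.left_ssubset
  have hQ := ih Q h.right_ssubset
  have clique : ∀ a b s t, G.Adj a s → G.Adj a t → G.Adj b s → G.Adj b t → G.Adj s t →
      G.Adj a b → 5 ≤ m := by
    intro a b s t has hat hbs hbt hst hab
    rcases hdich {a, b, s, t} with ⟨c, hc, hk⟩ | ⟨P, Q, s', t', h⟩
    · have h4 : ({k, c a, c b, c s, c t} : Finset (Fin m)).card = 5 := by
        have h1 := hc a (by simp) b (by simp) hab
        have h2 := hc a (by simp) s (by simp) has
        have h3 := hc a (by simp) t (by simp) hat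
        have h4 := hc b (by simp) s (by simp) hbs
        have h5 := hc b (by simp) t (by simp) hbt
        have h6 := hc s (by simp) t (by simp) hst
        have := (hk a).symm
        have := (hk b).symm
        have := (hk s).symm
        have := (hk t).symm
        rw [Finset.card_insert_of_notMem, Finset.card_insert_of_notMem,
          Finset.card_insert_of_notMem, Finset.card_pair] <;> simp_all
      have := Finset.card_le_univ ({k, c a, c b, c s, c t} : Finset (Fin m))
      simp only [Fintype.card_fin] at this
      omega
    · exfalso
      obtain ⟨u, hu, huQ⟩ := Finset.exists_of_ssubset h.right_ssubset
      obtain ⟨v, hv, hvP⟩ := Finset.exists_of_ssubset h.left_ssubset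
      have huP := ((h.mem_iff u).1 hu).resolve_right huQ
      have hvQ := ((h.mem_iff v).1 hv).resolve_left hvP
      have huv : u ≠ v := fun h => huQ (h ▸ hvQ)
      have hadj := h.not_adj u huP v hvQ huQ hvP
      simp only [Finset.mem_insert, Finset.mem_singleton] at hu hv
      have := G.adj_comm
      rcases hu with rfl | rfl | rfl | rfl <;> rcases hv with rfl | rfl | rfl | rfl <;> grind
  have hmem := h.mem_iff
  refine ⟨fun x hx y hy hxy => ?_, fun y hy a ha b hb hya hyb => ?_,
    fun x hx y hy z hz _ _ _ hxy hxz hyz => ?_⟩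
  · by_cases hxyP : x ∈ P ∧ y ∈ P
    · obtain ⟨c, hc, h1⟩ := hP.exists_eq x hxyP.1 y hxyP.2 hxy
      obtain ⟨e, he, h2⟩ := h.extend hQ hc
      exact ⟨e, he, by grind⟩
    by_cases hxyQ : x ∈ Q ∧ y ∈ Q
    · obtain ⟨c, hc, h1⟩ := hQ.exists_eq x hxyQ.1 y hxyQ.2 hxy
      obtain ⟨e, he, h2⟩ := h.symm.extend hP hc
      exact ⟨e, he, by grind⟩
    by_cases hxP : x ∈ P
    · exact h.exists_eq hP hQ hxP (by grind) (by grind) (by grind)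
    · exact h.symm.exists_eq hQ hP (by grind) hxP (by grind) (by grind)
  · have inside : ∀ {P Q}, G.TwoSep U P Q s t → Flexible G m P → Flexible G m Q →
        y ∈ P → a ∈ P → b ∈ P → ∃ c : V → Fin m, G.ProperOn U c ∧ c y ≠ c a ∧ c y ≠ c b := by
      intro P Q h hP hQ hy ha hb
      obtain ⟨c, hc, h1⟩ := hP.exists_ne y hy a ha b hb hya hyb
      obtain ⟨e, he, h2⟩ := h.extend hQ hc
      exact ⟨e, he, by grind⟩
    have left : ∀ {P Q}, G.TwoSep U P Q s t → Flexible G m P → Flexible G m Q →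
        y ∈ P → ∃ c : V → Fin m, G.ProperOn U c ∧ c y ≠ c a ∧ c y ≠ c b := by
      intro P Q h hP hQ hy
      have hmem := h.mem_iff
      by_cases haP : a ∈ P <;> by_cases hbP : b ∈ P
      · exact inside h hP hQ hy haP hbP
      · obtain ⟨c, hc, h1, h2⟩ := h.exists_ne_of_right hm hP hQ (by grind) hbP hy haP hya
        exact ⟨c, hc, h2, h1⟩
      · exact h.exists_ne_of_right hm hP hQ (by grind) haP hy hbP hyb
      · by_cases hyQ : y ∈ Q
        · exact inside h.symm hQ hP hyQ (by grind) (by grind)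
        · exact h.symm.exists_ne_of_left hm hQ hP hy hyQ (by grind) (by grind) (clique a b s t)
    rcases (hmem y).1 hy with hy | hy
    · exact left h hP hQ hy
    · exact left h.symm hQ hP hy
  · have inside : ∀ {P Q}, G.TwoSep U P Q s t → Flexible G m P → Flexible G m Q →
        x ∈ P → y ∈ P → z ∈ P →
        ∃ c : V → Fin m, G.ProperOn U c ∧ ExactlyTwoEq (c x) (c y) (c z) := by
      intro P Q h hP hQ hx hy hz
      obtain ⟨c, hc, h1⟩ := hP.exists_two_eq x hx y hy z hz ‹_› ‹_› ‹_› hxy hxz hyz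
      obtain ⟨e, he, h2⟩ := h.extend hQ hc
      exact ⟨e, he, by rwa [h2 x hx, h2 y hy, h2 z hz]⟩
    have left : ∀ {P Q}, G.TwoSep U P Q s t → Flexible G m P → Flexible G m Q →
        x ∈ P → ∃ c : V → Fin m, G.ProperOn U c ∧ ExactlyTwoEq (c x) (c y) (c z) := by
      intro P Q h hP hQ hx
      have hmem := h.mem_iff
      by_cases hyP : y ∈ P <;> by_cases hzP : z ∈ P
      · exact inside h hP hQ hx hyP hzP
      · obtain ⟨c, hc, h1⟩ := h.exists_two_eq hm hP hQ (by grind) hzP hx hyP hxy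
        exact ⟨c, hc, by unfold ExactlyTwoEq at *; grind⟩
      · obtain ⟨c, hc, h1⟩ := h.exists_two_eq hm hP hQ (by grind) hyP hx hzP hxz
        exact ⟨c, hc, by unfold ExactlyTwoEq at *; grind⟩
      · by_cases hxQ : x ∈ Q
        · exact inside h.symm hQ hP hxQ (by grind) (by grind)
        · exact h.symm.exists_two_eq hm hQ hP hx hxQ (by grind) (by grind) hyz
    rcases (hmem x).1 hx with hx | hx
    · exact left h hP hQ hx
    · exact left h.symm hQ hP hx

/-- A partition of `U` into two nonempty sets with no edges between them and a set of at most two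
vertices yields a separation of order exactly two. -/
lemma exists_twoSep [DecidableEq V] (n : ℕ) {A B S : Finset V} (hS : S.card + n = 2)
    (hA : A.Nonempty) (hB : B.Nonempty) (hAB : Disjoint A B) (hAS : Disjoint A S)
    (hBS : Disjoint B S) (hadj : ∀ u ∈ A, ∀ v ∈ B, ¬ G.Adj u v)
    (hcard : 4 ≤ A.card + B.card + S.card) : ∃ P Q s t, G.TwoSep (A ∪ B ∪ S) P Q s t := by
  induction n generalizing A B S with
  | zero =>
    obtain ⟨s, t, hst, rfl⟩ := Finset.card_eq_two.1 (by simpa using hS)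
    obtain ⟨a, ha⟩ := hA
    obtain ⟨b, hb⟩ := hB
    rw [Finset.disjoint_left] at hAB hAS hBS
    have haB := hAB ha
    have haS := hAS ha
    have hbS := hBS hb
    have hbA : b ∉ A := fun h => hAB h hb
    refine ⟨A ∪ {s, t}, B ∪ {s, t}, s, t, ?_, ?_, by grind, by grind, hst, by grind⟩
    · refine Finset.ssubset_iff_of_subset (by grind) |>.2 ⟨b, by grind, by grind⟩
    · refine Finset.ssubset_iff_of_subset (by grind) |>.2 ⟨a, by grind, by grind⟩
  | succ n ih =>
    by_cases h2 : 2 ≤ A.card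
    · obtain ⟨a, ha⟩ := hA
      have haS : a ∉ S := Finset.disjoint_left.1 hAS ha
      have haB : a ∉ B := Finset.disjoint_left.1 hAB ha
      have := ih (A := A.erase a) (B := B) (S := insert a S)
        (by rw [Finset.card_insert_of_notMem haS]; omega)
        (Finset.card_pos.1 (by rw [Finset.card_erase_of_mem ha]; omega)) hB
        (by rw [Finset.disjoint_left] at *; grind) (by rw [Finset.disjoint_left] at *; grind)
        (by rw [Finset.disjoint_left] at *; grind) (by grind)
        (by rw [Finset.card_insert_of_notMem haS, Finset.card_erase_of_mem ha]; omega)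
      rwa [show A.erase a ∪ B ∪ insert a S = A ∪ B ∪ S by grind] at this
    · have h3 : 2 ≤ B.card := by omega
      obtain ⟨b, hb⟩ := hB
      have hbS : b ∉ S := Finset.disjoint_left.1 hBS hb
      have hbA : b ∉ A := Finset.disjoint_right.1 hAB hb
      have := ih (A := A) (B := B.erase b) (S := insert b S)
        (by rw [Finset.card_insert_of_notMem hbS]; omega) hA
        (Finset.card_pos.1 (by rw [Finset.card_erase_of_mem hb]; omega))
        (by rw [Finset.disjoint_left] at *; grind) (by rw [Finset.disjoint_left] at *; grind)
        (by rw [Finset.disjoint_left] at *; grind) (by grind)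
        (by rw [Finset.card_insert_of_notMem hbS, Finset.card_erase_of_mem hb]; omega)
      rwa [show A ∪ B.erase b ∪ insert b S = A ∪ B ∪ S by grind] at this

/-- Every induced subgraph of an `m`-fragile graph has a colouring avoiding the last of `m` colours
or a separation of order two. -/
lemma MFragile.dichotomy (hm : 4 ≤ m) (hG : G.MFragile m) (U : Finset V) :
    (∃ c : V → Fin m, G.ProperOn U c ∧ ∀ v, c v ≠ ⟨m - 1, by omega⟩) ∨
      ∃ P Q s t, G.TwoSep U P Q s t := by
  classical
  set H := (⊤ : G.Subgraph).induce (U : Set V) with hH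
  have hcardH : Nat.card H.verts = U.card := by simp [hH]
  by_cases hcol : H.coe.Colorable (m - 1)
  · left
    obtain ⟨C⟩ := hcol
    refine ⟨fun v => if h : v ∈ U then (C ⟨v, h⟩).castLE (by omega) else ⟨0, by omega⟩, ?_, ?_⟩
    · intro u hu v hv huv
      have h1 : H.coe.Adj ⟨u, hu⟩ ⟨v, hv⟩ := by simp [hH, hu, hv, huv]
      have h2 := C.valid h1
      simpa [hu, hv] using h2
    · intro v
      dsimp only
      split_ifs with h
      · have := (C ⟨v, h⟩).isLt
        simp only [ne_eq, Fin.ext_iff, Fin.val_castLE]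
        omega
      · simp only [ne_eq, Fin.ext_iff]
        omega
  right
  have hfin : Finite H.verts := U.finite_toSet
  have hcard : 4 ≤ U.card := by
    by_contra hlt
    have := Fintype.ofFinite H.verts
    refine hcol (H.coe.colorable_of_fintype.mono ?_)
    rw [← Nat.card_eq_fintype_card, hcardH]
    omega
  have hnot : ¬ H.coe.IsKConnected 3 := fun h => hcol (hG H h)
  simp only [IsKConnected, hcardH, not_and, not_forall] at hnot
  obtain ⟨S, hS, hconn⟩ := hnot hcard
  have hU : ∀ {w}, w ∈ U → w ∈ H.verts := fun h => h
  have hne : Nonempty ↥(Sᶜ : Set H.verts) := by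
    rw [Set.nonempty_coe_sort, Set.nonempty_compl]
    rintro rfl
    rw [Set.ncard_univ, hcardH] at hS
    omega
  have hpre : ¬ (H.coe.induce Sᶜ).Preconnected := fun h => hconn ⟨h⟩
  simp only [Preconnected, not_forall] at hpre
  obtain ⟨u, v, huv⟩ := hpre
  set A : Finset V := {w ∈ U | ∃ (h : w ∈ H.verts) (h' : ⟨w, h⟩ ∈ Sᶜ),
    (H.coe.induce Sᶜ).Reachable u ⟨⟨w, h⟩, h'⟩} with hA
  set B : Finset V := {w ∈ U | ∃ (h : w ∈ H.verts) (h' : ⟨w, h⟩ ∈ Sᶜ),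
    ¬ (H.coe.induce Sᶜ).Reachable u ⟨⟨w, h⟩, h'⟩} with hB
  set T : Finset V := {w ∈ U | ∃ h : w ∈ H.verts, ⟨w, h⟩ ∈ S} with hT
  have hAB : Disjoint A B := by
    rw [Finset.disjoint_left]
    intro w hwA hwB
    obtain ⟨-, h, h', hr⟩ := Finset.mem_filter.1 hwA
    obtain ⟨-, h, h', hr'⟩ := Finset.mem_filter.1 hwB
    exact hr' hr
  have hAT : Disjoint A T := by
    rw [Finset.disjoint_left]
    intro w hwA hwT
    obtain ⟨-, h, h', -⟩ := Finset.mem_filter.1 hwA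
    obtain ⟨-, h, hw⟩ := Finset.mem_filter.1 hwT
    exact h' hw
  have hBT : Disjoint B T := by
    rw [Finset.disjoint_left]
    intro w hwB hwT
    obtain ⟨-, h, h', -⟩ := Finset.mem_filter.1 hwB
    obtain ⟨-, h, hw⟩ := Finset.mem_filter.1 hwT
    exact h' hw
  have hunion : A ∪ B ∪ T = U := by
    ext w
    simp only [Finset.mem_union]
    refine ⟨by rintro ((h | h) | h) <;> exact (Finset.mem_filter.1 h).1, fun hw => ?_⟩
    by_cases hwS : (⟨w, hU hw⟩ : H.verts) ∈ S
    · exact Or.inr (Finset.mem_filter.2 ⟨hw, _, hwS⟩)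
    · by_cases hr : (H.coe.induce Sᶜ).Reachable u ⟨⟨w, hU hw⟩, hwS⟩
      · exact Or.inl (Or.inl (Finset.mem_filter.2 ⟨hw, _, _, hr⟩))
      · exact Or.inl (Or.inr (Finset.mem_filter.2 ⟨hw, _, _, hr⟩))
  have hTcard : T.card = S.ncard := by
    rw [← Set.ncard_image_of_injective S Subtype.val_injective, ← Set.ncard_coe_finset]
    congr 1
    ext w
    simp only [hT, Finset.coe_filter, Set.mem_ofPred_eq, Set.mem_image, Subtype.exists,
      exists_and_right, exists_eq_right]
    exact ⟨fun h => h.2, fun h => ⟨h.1, h⟩⟩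
  have hadj : ∀ a ∈ A, ∀ b ∈ B, ¬ G.Adj a b := by
    intro a ha b hb hab
    obtain ⟨haU, h1, h1', hr⟩ := Finset.mem_filter.1 ha
    obtain ⟨hbU, h2, h2', hr'⟩ := Finset.mem_filter.1 hb
    refine hr' (hr.trans (Adj.reachable ?_))
    simp [hH, haU, hbU, hab]
  have hsum : A.card + B.card + T.card = U.card := by
    rw [← hunion, Finset.card_union_of_disjoint (Finset.disjoint_union_left.2 ⟨hAT, hBT⟩),
      Finset.card_union_of_disjoint hAB]
  rw [← hunion]
  exact exists_twoSep (2 - T.card) (by omega)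
    ⟨u.1.1, Finset.mem_filter.2 ⟨u.1.2, u.1.2, u.2, Reachable.refl _⟩⟩
    ⟨v.1.1, Finset.mem_filter.2 ⟨v.1.2, v.1.2, v.2, huv⟩⟩ hAB hAT hBT hadj (by omega)

end SimpleGraph

/-- Every `m`-fragile graph admits an `m`-colouring separating any two given
distinct vertices. -/
theorem statement4 {V : Type*} [Fintype V] (G : SimpleGraph V) (m : ℕ) (hm : 4 ≤ m)
    (hG : G.MFragile m) (x y : V) (hxy : x ≠ y) :
    ∃ c : V → ℕ, (∀ v, c v ∈ Finset.Icc 1 m) ∧ (∀ u v, G.Adj u v → c u ≠ c v) ∧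
      c x ≠ c y := by
  obtain ⟨c, hc, h⟩ := (SimpleGraph.flexible_of_dichotomy hm _ (hG.dichotomy hm)
    Finset.univ).exists_ne' (Finset.mem_univ x) (Finset.mem_univ y) hxy
  refine ⟨fun v => c v + 1, fun v => ?_, fun u v huv => ?_, ?_⟩
  · have := (c v).isLt
    simp only [Finset.mem_Icc]
    omega
  · simpa [Fin.ext_iff] using hc u (Finset.mem_univ u) v (Finset.mem_univ v) huv
  · simpa [Fin.ext_iff] using h
end

section
/- For every integer m ≥ 4, every m-fragile finite simple graph G satisfies: for all pairwise distinct vertices x, y, z of G that are not all pairwise adjacent, there exists a proper colouring c of G with colours from {1, …, m} such that the set {c(x), c(y), c(z)} has exactly 2 elements. -/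
namespace FragileColouring

/-- `c` is a proper colouring of the subgraph of `G` induced by `W`. -/
def ProperOn {V : Type*} {m : ℕ} (G : SimpleGraph V) (W : Finset V) (c : V → Fin m) : Prop :=
  ∀ u ∈ W, ∀ v ∈ W, G.Adj u v → c u ≠ c v

/-- Exactly two of the three given colours are distinct. -/
def ExactlyTwo {α : Type*} (p q r : α) : Prop :=
  ¬ (p = q ∧ q = r) ∧ (p = q ∨ q = r ∨ p = r)

/-- The colouring properties which are proved simultaneously by induction on `W`. -/
structure Flexible {V : Type*} (G : SimpleGraph V) (m : ℕ) (W : Finset V) : Prop where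
  two : ∀ x ∈ W, ∀ y ∈ W, ∀ z ∈ W, x ≠ y → x ≠ z → y ≠ z →
    ¬ (G.Adj x y ∧ G.Adj y z ∧ G.Adj x z) →
    ∃ c : V → Fin m, ProperOn G W c ∧ ExactlyTwo (c x) (c y) (c z)
  apart : ∀ x ∈ W, ∀ s ∈ W, ∀ t ∈ W, x ≠ s → x ≠ t →
    ∃ c : V → Fin m, ProperOn G W c ∧ c x ≠ c s ∧ c x ≠ c t
  equal : ∀ x ∈ W, ∀ y ∈ W, x ≠ y → ¬ G.Adj x y →
    ∃ c : V → Fin m, ProperOn G W c ∧ c x = c y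
  escape : ∀ x ∈ W, ∀ z ∈ W, ∀ s ∈ W, ∀ t ∈ W, x ≠ s → x ≠ t → z ≠ s → z ≠ t →
    G.Adj x z → G.Adj s t →
    ∃ c : V → Fin m, ProperOn G W c ∧
      ((c x ≠ c s ∧ c x ≠ c t) ∨ (c z ≠ c s ∧ c z ≠ c t))

/-- `W` is covered by proper subsets `C` and `D` which meet exactly in `{a, b}`, and there is no
edge between `C \ D` and `D \ C`. -/
structure TwoCut {V : Type*} (G : SimpleGraph V) (W C D : Finset V) (a b : V) : Prop where
  left : C ⊂ W
  right : D ⊂ W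
  ne : a ≠ b
  aC : a ∈ C
  bC : b ∈ C
  aD : a ∈ D
  bD : b ∈ D
  cover : ∀ v ∈ W, v ∈ C ∨ v ∈ D
  inter : ∀ v ∈ C, v ∈ D → v = a ∨ v = b
  noEdge : ∀ u ∈ C, ∀ v ∈ D, u ∉ D → v ∉ C → ¬ G.Adj u v

theorem TwoCut.symm {V : Type*} {G : SimpleGraph V} {W C D : Finset V} {a b : V}
    (h : TwoCut G W C D a b) : TwoCut G W D C a b :=
  ⟨h.right, h.left, h.ne, h.aD, h.bD, h.aC, h.bC, fun v hv => (h.cover v hv).symm,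
    fun v hD hC => h.inter v hC hD, fun u hu v hv hu' hv' e => h.noEdge v hv u hu hv' hu' e.symm⟩

theorem TwoCut.swap {V : Type*} {G : SimpleGraph V} {W C D : Finset V} {a b : V}
    (h : TwoCut G W C D a b) : TwoCut G W C D b a :=
  ⟨h.left, h.right, h.ne.symm, h.bC, h.aC, h.bD, h.aD, h.cover,
    fun v hC hD => (h.inter v hC hD).symm, h.noEdge⟩

theorem exists_perm_three {α : Type*} (p₁ p₂ p₃ q₁ q₂ q₃ : α)
    (h₁₂ : p₁ = p₂ ↔ q₁ = q₂) (h₁₃ : p₁ = p₃ ↔ q₁ = q₃) (h₂₃ : p₂ = p₃ ↔ q₂ = q₃) :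
    ∃ σ : Equiv.Perm α, σ p₁ = q₁ ∧ σ p₂ = q₂ ∧ σ p₃ = q₃ := by
  classical
  obtain ⟨σ, hσ⟩ : ∃ σ : Equiv.Perm α, σ p₁ = q₁ := ⟨Equiv.swap p₁ q₁, by simp⟩
  obtain ⟨τ, h1, h2⟩ : ∃ τ : Equiv.Perm α, τ p₁ = q₁ ∧ τ p₂ = q₂ := by
    refine ⟨σ.trans (Equiv.swap (σ p₂) q₂), ?_, by simp⟩
    by_cases h : p₁ = p₂
    · subst h; simp [h₁₂.mp rfl]
    · have h' : q₁ ≠ q₂ := fun e => h (h₁₂.mpr e)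
      have h'' : q₁ ≠ σ p₂ := fun e => h (σ.injective (hσ.trans e))
      simp [hσ, Equiv.swap_apply_of_ne_of_ne h'' h']
  refine ⟨τ.trans (Equiv.swap (τ p₃) q₃), ?_, ?_, by simp⟩
  · by_cases h : p₁ = p₃
    · subst h; simp [h₁₃.mp rfl]
    · have h' : q₁ ≠ q₃ := fun e => h (h₁₃.mpr e)
      have h'' : q₁ ≠ τ p₃ := fun e => h (τ.injective (h1.trans e))
      simp [h1, Equiv.swap_apply_of_ne_of_ne h'' h']
  · by_cases h : p₂ = p₃
    · subst h; simp [h₂₃.mp rfl]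
    · have h' : q₂ ≠ q₃ := fun e => h (h₂₃.mpr e)
      have h'' : q₂ ≠ τ p₃ := fun e => h (τ.injective (h2.trans e))
      simp [h2, Equiv.swap_apply_of_ne_of_ne h'' h']

theorem exists_fresh_three {m : ℕ} (hm : 4 ≤ m) (p q r : Fin m) :
    ∃ d : Fin m, d ≠ p ∧ d ≠ q ∧ d ≠ r := by
  obtain ⟨d, hd⟩ : ∃ d, d ∉ ({p, q, r} : Finset (Fin m)) := by
    by_contra! h
    have h1 := Finset.card_le_card (fun x _ => h x : (Finset.univ : Finset (Fin m)) ⊆ _)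
    have h2 := Finset.card_le_three (a := p) (b := q) (c := r)
    simp at h1
    omega
  simp at hd
  exact ⟨d, hd⟩

theorem exists_fresh_four {m : ℕ} (hm : 5 ≤ m) (p q r s : Fin m) :
    ∃ d : Fin m, d ≠ p ∧ d ≠ q ∧ d ≠ r ∧ d ≠ s := by
  obtain ⟨d, hd⟩ : ∃ d, d ∉ ({p, q, r, s} : Finset (Fin m)) := by
    by_contra! h
    have h1 := Finset.card_le_card (fun x _ => h x : (Finset.univ : Finset (Fin m)) ⊆ _)
    have h2 := Finset.card_le_four (a := p) (b := q) (c := r) (d := s)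
    simp at h1
    omega
  simp at hd
  exact ⟨d, hd⟩

section Glue

variable {V : Type*} {G : SimpleGraph V} {m : ℕ} {W C D : Finset V} {a b : V}

/-- Two colourings that agree on `{a, b}` up to renaming colours can be glued, with the colour of
one further vertex `y` of `D` prescribed. -/
theorem TwoCut.glue (h : TwoCut G W C D a b) {c₁ c₂ : V → Fin m} (h₁ : ProperOn G C c₁)
    (h₂ : ProperOn G D c₂) (hab : c₁ a = c₁ b ↔ c₂ a = c₂ b) {y : V} (hy : y ∈ D) (q : Fin m)
    (hqa : q = c₁ a ↔ c₂ y = c₂ a) (hqb : q = c₁ b ↔ c₂ y = c₂ b) :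
    ∃ c : V → Fin m, ProperOn G W c ∧ (∀ v ∈ C, c v = c₁ v) ∧ c y = q ∧
      ∀ u ∈ D, ∀ v ∈ D, (c u = c v ↔ c₂ u = c₂ v) := by
  classical
  obtain ⟨σ, ha, hb, hq⟩ := exists_perm_three (c₂ a) (c₂ b) (c₂ y) (c₁ a) (c₁ b) q hab.symm
    (by grind) (by grind)
  let c : V → Fin m := fun v => if v ∈ C then c₁ v else σ (c₂ v)
  have hC : ∀ v ∈ C, c v = c₁ v := fun v hv => if_pos hv
  have hD : ∀ v ∈ D, c v = σ (c₂ v) := by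
    intro v hv
    by_cases hvC : v ∈ C
    · rw [hC v hvC]
      rcases h.inter v hvC hv with rfl | rfl
      · exact ha.symm
      · exact hb.symm
    · exact if_neg hvC
  refine ⟨c, ?_, hC, by rw [hD y hy, hq], fun u hu v hv => by
    rw [hD u hu, hD v hv, σ.injective.eq_iff]⟩
  intro u hu v hv e
  by_cases huC : u ∈ C
  · by_cases hvC : v ∈ C
    · rw [hC u huC, hC v hvC]; exact h₁ u huC v hvC e
    · have hvD := (h.cover v hv).resolve_left hvC
      by_cases huD : u ∈ D
      · rw [hD u huD, hD v hvD]
        exact fun e' => h₂ u huD v hvD e (σ.injective e')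
      · exact absurd e (h.noEdge u huC v hvD huD hvC)
  · have huD := (h.cover u hu).resolve_left huC
    by_cases hvD : v ∈ D
    · rw [hD u huD, hD v hvD]
      exact fun e' => h₂ u huD v hvD e (σ.injective e')
    · have hvC := (h.cover v hv).resolve_right hvD
      exact absurd e.symm (h.noEdge v hvC u huD hvD huC)

/-- Gluing without a prescribed further vertex. -/
theorem TwoCut.glue' (h : TwoCut G W C D a b) {c₁ c₂ : V → Fin m} (h₁ : ProperOn G C c₁)
    (h₂ : ProperOn G D c₂) (hab : c₁ a = c₁ b ↔ c₂ a = c₂ b) :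
    ∃ c : V → Fin m, ProperOn G W c ∧ (∀ v ∈ C, c v = c₁ v) ∧
      ∀ u ∈ D, ∀ v ∈ D, (c u = c v ↔ c₂ u = c₂ v) := by
  obtain ⟨c, hc, hC, -, hD⟩ := h.glue h₁ h₂ hab h.aD (c₁ a) (by simp) hab
  exact ⟨c, hc, hC, hD⟩

theorem TwoCut.exists_matching (h : TwoCut G W C D a b) (hD : Flexible G m D)
    {c₁ : V → Fin m} (h₁ : ProperOn G C c₁) :
    ∃ c₂ : V → Fin m, ProperOn G D c₂ ∧ (c₁ a = c₁ b ↔ c₂ a = c₂ b) := by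
  by_cases hab : c₁ a = c₁ b
  · obtain ⟨c₂, h₂, h'⟩ := hD.equal a h.aD b h.bD h.ne fun e => h₁ a h.aC b h.bC e hab
    exact ⟨c₂, h₂, by simp [hab, h']⟩
  · obtain ⟨c₂, h₂, h', -⟩ := hD.apart a h.aD b h.bD b h.bD h.ne h.ne
    exact ⟨c₂, h₂, by simp [hab, h']⟩

theorem TwoCut.extend (h : TwoCut G W C D a b) (hD : Flexible G m D)
    {c₁ : V → Fin m} (h₁ : ProperOn G C c₁) :
    ∃ c : V → Fin m, ProperOn G W c ∧ ∀ v ∈ C, c v = c₁ v := by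
  obtain ⟨c₂, h₂, hab⟩ := h.exists_matching hD h₁
  obtain ⟨c, hc, hC, -⟩ := h.glue' h₁ h₂ hab
  exact ⟨c, hc, hC⟩

/-- If `x` can avoid the colours of `a` and `b` in `C` then, after gluing, it can be given
any colour not used on `a` and `b`. -/
theorem TwoCut.glue_avoid (h : TwoCut G W C D a b) {c₁ c₂ : V → Fin m} (h₁ : ProperOn G C c₁)
    (h₂ : ProperOn G D c₂) (hab : c₁ a = c₁ b ↔ c₂ a = c₂ b) {x : V} (hx : x ∈ C)
    (hxa : c₁ x ≠ c₁ a) (hxb : c₁ x ≠ c₁ b) {d : Fin m} (hda : d ≠ c₂ a) (hdb : d ≠ c₂ b) :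
    ∃ c : V → Fin m, ProperOn G W c ∧ (∀ v ∈ D, c v = c₂ v) ∧ c x = d := by
  obtain ⟨c, hc, hD, hx, -⟩ := h.symm.glue h₂ h₁ hab.symm hx d (by simp [hxa, hda])
    (by simp [hxb, hdb])
  exact ⟨c, hc, hD, hx⟩

end Glue

section Steps

variable {V : Type*} {G : SimpleGraph V} {m : ℕ} {W C D : Finset V} {a b : V}

/-- Unless `m ≤ 4` and the vertices form a clique, four vertices can be coloured so that some
colour is missing. -/
theorem Flexible.exists_fresh (hm : 4 ≤ m)
    (hK : m ≤ 4 → ∀ p q r s, ¬ (G.Adj p q ∧ G.Adj p r ∧ G.Adj p s ∧ G.Adj q r ∧ G.Adj q s ∧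
      G.Adj r s)) (hD : Flexible G m D) {a b s t : V} (ha : a ∈ D)
    (hb : b ∈ D) (hs : s ∈ D) (ht : t ∈ D) (hab : a ≠ b) :
    ∃ (c : V → Fin m) (d : Fin m), ProperOn G D c ∧ d ≠ c a ∧ d ≠ c b ∧ d ≠ c s ∧ d ≠ c t := by
  obtain ⟨c₀, h₀, -, -⟩ := hD.apart a ha b hb b hb hab hab
  rcases Nat.lt_or_ge 4 m with h5 | h4
  · obtain ⟨d, hd⟩ := exists_fresh_four h5 (c₀ a) (c₀ b) (c₀ s) (c₀ t)
    exact ⟨c₀, d, h₀, hd⟩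
  have key : ∀ u ∈ D, ∀ v ∈ D, ¬ G.Adj u v → ∃ c : V → Fin m, ProperOn G D c ∧ c u = c v := by
    intro u hu v hv huv
    by_cases e : u = v
    · exact ⟨c₀, h₀, by rw [e]⟩
    · exact hD.equal u hu v hv e huv
  have main : ∃ c : V → Fin m, ProperOn G D c ∧ (c a = c b ∨ c a = c s ∨ c a = c t ∨
      c b = c s ∨ c b = c t ∨ c s = c t) := by
    have := hK h4 a b s t
    simp only [not_and_or] at this
    rcases this with e | e | e | e | e | e
    · obtain ⟨c, hc, h⟩ := key _ ha _ hb e; exact ⟨c, hc, by simp [h]⟩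
    · obtain ⟨c, hc, h⟩ := key _ ha _ hs e; exact ⟨c, hc, by simp [h]⟩
    · obtain ⟨c, hc, h⟩ := key _ ha _ ht e; exact ⟨c, hc, by simp [h]⟩
    · obtain ⟨c, hc, h⟩ := key _ hb _ hs e; exact ⟨c, hc, by simp [h]⟩
    · obtain ⟨c, hc, h⟩ := key _ hb _ ht e; exact ⟨c, hc, by simp [h]⟩
    · obtain ⟨c, hc, h⟩ := key _ hs _ ht e; exact ⟨c, hc, by simp [h]⟩
  obtain ⟨c, hc, h⟩ := main
  rcases h with h | h | h | h | h | h
  · obtain ⟨d, hd⟩ := exists_fresh_three hm (c b) (c s) (c t); exact ⟨c, d, hc, by grind⟩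
  · obtain ⟨d, hd⟩ := exists_fresh_three hm (c b) (c s) (c t); exact ⟨c, d, hc, by grind⟩
  · obtain ⟨d, hd⟩ := exists_fresh_three hm (c b) (c s) (c t); exact ⟨c, d, hc, by grind⟩
  · obtain ⟨d, hd⟩ := exists_fresh_three hm (c a) (c s) (c t); exact ⟨c, d, hc, by grind⟩
  · obtain ⟨d, hd⟩ := exists_fresh_three hm (c a) (c s) (c t); exact ⟨c, d, hc, by grind⟩
  · obtain ⟨d, hd⟩ := exists_fresh_three hm (c a) (c b) (c t); exact ⟨c, d, hc, by grind⟩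

theorem TwoCut.apart_opposite (hm : 4 ≤ m)
    (hK : m ≤ 4 → ∀ p q r s, ¬ (G.Adj p q ∧ G.Adj p r ∧ G.Adj p s ∧ G.Adj q r ∧ G.Adj q s ∧
      G.Adj r s)) (h : TwoCut G W C D a b) (hC : Flexible G m C)
    (hD : Flexible G m D) {x s t : V} (hx : x ∈ C) (hx' : x ∉ D) (hs : s ∈ D) (ht : t ∈ D) :
    ∃ c : V → Fin m, ProperOn G W c ∧ c x ≠ c s ∧ c x ≠ c t := by
  have hxa : x ≠ a := fun e => hx' (e ▸ h.aD)
  have hxb : x ≠ b := fun e => hx' (e ▸ h.bD)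
  obtain ⟨c₁, h₁, h₁a, h₁b⟩ := hC.apart x hx a h.aC b h.bC hxa hxb
  have fin : ∀ {c₁ c₂ : V → Fin m} {d : Fin m}, ProperOn G C c₁ → ProperOn G D c₂ →
      (c₁ a = c₁ b ↔ c₂ a = c₂ b) → c₁ x ≠ c₁ a → c₁ x ≠ c₁ b → d ≠ c₂ a → d ≠ c₂ b →
      d ≠ c₂ s → d ≠ c₂ t → ∃ c : V → Fin m, ProperOn G W c ∧ c x ≠ c s ∧ c x ≠ c t := by
    intro c₁ c₂ d h₁ h₂ hab h₁a h₁b da db ds dt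
    obtain ⟨c, hc, hD', hcx⟩ := h.glue_avoid h₁ h₂ hab hx h₁a h₁b da db
    exact ⟨c, hc, by rwa [hcx, hD' s hs], by rwa [hcx, hD' t ht]⟩
  have same : ∀ {c₁ : V → Fin m}, ProperOn G C c₁ → c₁ x ≠ c₁ a → c₁ a = c₁ b →
      ∃ c : V → Fin m, ProperOn G W c ∧ c x ≠ c s ∧ c x ≠ c t := by
    intro c₁ h₁ h₁a e
    obtain ⟨c₂, h₂, hab⟩ := h.exists_matching hD h₁
    obtain ⟨d, da, ds, dt⟩ := exists_fresh_three hm (c₂ a) (c₂ s) (c₂ t)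
    exact fin h₁ h₂ hab h₁a (e ▸ h₁a) da (hab.mp e ▸ da) ds dt
  by_cases e₁ : c₁ a = c₁ b
  · exact same h₁ h₁a e₁
  by_cases hadj : G.Adj a b
  · obtain ⟨c₂, d, h₂, da, db, ds, dt⟩ := hD.exists_fresh hm hK h.aD h.bD hs ht h.ne
    exact fin h₁ h₂ (by simp [e₁, h₂ a h.aD b h.bD hadj]) h₁a h₁b da db ds dt
  obtain ⟨c₂, h₂, e₂, -⟩ := hD.apart a h.aD b h.bD b h.bD h.ne h.ne
  by_cases hd : ∃ d, d ≠ c₂ a ∧ d ≠ c₂ b ∧ d ≠ c₂ s ∧ d ≠ c₂ t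
  · obtain ⟨d, da, db, ds, dt⟩ := hd
    exact fin h₁ h₂ (by simp [e₁, e₂]) h₁a h₁b da db ds dt
  obtain ⟨c₃, h₃, hnot, htwo⟩ := hC.two x hx a h.aC b h.bC hxa hxb h.ne (fun e => hadj e.2.1)
  by_cases e₃ : c₃ a = c₃ b
  · exact same h₃ (by grind) e₃
  have hfour : c₂ a ≠ c₂ s ∧ c₂ a ≠ c₂ t ∧ c₂ b ≠ c₂ s ∧ c₂ b ≠ c₂ t := by
    obtain ⟨d₁, hd₁⟩ := exists_fresh_three hm (c₂ a) (c₂ b) (c₂ t)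
    obtain ⟨d₂, hd₂⟩ := exists_fresh_three hm (c₂ a) (c₂ b) (c₂ s)
    have h1 : d₁ = c₂ s := by by_contra e; exact hd ⟨d₁, hd₁.1, hd₁.2.1, e, hd₁.2.2⟩
    have h2 : d₂ = c₂ t := by by_contra e; exact hd ⟨d₂, hd₂.1, hd₂.2.1, hd₂.2.2, e⟩
    exact ⟨(h1 ▸ hd₁.1).symm, (h2 ▸ hd₂.1).symm, (h1 ▸ hd₁.2.1).symm, (h2 ▸ hd₂.2.1).symm⟩
  obtain ⟨c, hc, hC', hD'⟩ := h.glue' h₃ h₂ (by simp [e₃, e₂])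
  have ha := hC' a h.aC
  have hb := hC' b h.bC
  have hxc := hC' x hx
  have h1 := hD' a h.aD s hs
  have h2 := hD' a h.aD t ht
  have h3 := hD' b h.bD s hs
  have h4 := hD' b h.bD t ht
  exact ⟨c, hc, by grind, by grind⟩

theorem TwoCut.apart_mixed (hm : 4 ≤ m) (h : TwoCut G W C D a b) (hC : Flexible G m C)
    (hD : Flexible G m D) {x s t : V} (hx : x ∈ C) (hx' : x ∉ D) (hs : s ∈ C) (ht : t ∈ D)
    (hxs : x ≠ s) : ∃ c : V → Fin m, ProperOn G W c ∧ c x ≠ c s ∧ c x ≠ c t := by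
  have hxa : x ≠ a := fun e => hx' (e ▸ h.aD)
  have hxb : x ≠ b := fun e => hx' (e ▸ h.bD)
  obtain ⟨c₁, h₁, h₁s, h₁a⟩ := hC.apart x hx s hs a h.aC hxs hxa
  obtain ⟨c₃, h₃, h₃s, h₃b⟩ := hC.apart x hx s hs b h.bC hxs hxb
  have avoid : ∀ {c₁ : V → Fin m}, ProperOn G C c₁ → c₁ x ≠ c₁ s → c₁ x ≠ c₁ a → c₁ x ≠ c₁ b →
      ∃ c : V → Fin m, ProperOn G W c ∧ c x ≠ c s ∧ c x ≠ c t := by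
    intro c₁ h₁ h₁s h₁a h₁b
    obtain ⟨c₂, h₂, hab⟩ := h.exists_matching hD h₁
    by_cases hta : c₂ t = c₂ a
    · obtain ⟨c, hc, hC', ht', -⟩ := h.glue h₁ h₂ hab ht (c₁ a) (by simp [hta]) (by rw [hta, hab])
      exact ⟨c, hc, by rwa [hC' x hx, hC' s hs], by rwa [hC' x hx, ht']⟩
    by_cases htb : c₂ t = c₂ b
    · obtain ⟨c, hc, hC', ht', -⟩ := h.glue h₁ h₂ hab ht (c₁ b) (by grind) (by simp [htb])
      exact ⟨c, hc, by rwa [hC' x hx, hC' s hs], by rwa [hC' x hx, ht']⟩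
    obtain ⟨d, da, db, dx⟩ := exists_fresh_three hm (c₁ a) (c₁ b) (c₁ x)
    obtain ⟨c, hc, hC', ht', -⟩ := h.glue h₁ h₂ hab ht d (by simp [hta, da]) (by simp [htb, db])
    exact ⟨c, hc, by rwa [hC' x hx, hC' s hs], by rw [hC' x hx, ht']; exact dx.symm⟩
  by_cases h₁b : c₁ x = c₁ b
  swap
  · exact avoid h₁ h₁s h₁a h₁b
  by_cases h₃a : c₃ x = c₃ a
  swap
  · exact avoid h₃ h₃s h₃a h₃b
  obtain ⟨c₂, h₂, e₂, -⟩ := hD.apart a h.aD b h.bD b h.bD h.ne h.ne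
  by_cases hta : c₂ t = c₂ a
  · obtain ⟨c, hc, hC', hD'⟩ := h.glue' h₁ h₂ (by grind)
    have ha := hC' a h.aC
    have hxc := hC' x hx
    have hsc := hC' s hs
    have h1 := hD' t ht a h.aD
    exact ⟨c, hc, by grind, by grind⟩
  · obtain ⟨c, hc, hC', hD'⟩ := h.glue' h₃ h₂ (by grind)
    have ha := hC' a h.aC
    have hxc := hC' x hx
    have hsc := hC' s hs
    have h1 := hD' t ht a h.aD
    exact ⟨c, hc, by grind, by grind⟩

theorem TwoCut.apart_of_eq (h : TwoCut G W C D a b) (hC : Flexible G m C)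
    (hD : Flexible G m D) {s t : V} (hs : s ∈ C) (ht : t ∈ D)
    (has : a ≠ s) (hat : a ≠ t) : ∃ c : V → Fin m, ProperOn G W c ∧ c a ≠ c s ∧ c a ≠ c t := by
  obtain ⟨c₁, h₁, h₁s, h₁b⟩ := hC.apart a h.aC s hs b h.bC has h.ne
  obtain ⟨c₂, h₂, h₂t, h₂b⟩ := hD.apart a h.aD t ht b h.bD hat h.ne
  obtain ⟨c, hc, hC', hD'⟩ := h.glue' h₁ h₂ (by simp [h₁b, h₂b])
  exact ⟨c, hc, by rwa [hC' a h.aC, hC' s hs], by rwa [Ne, hD' a h.aD t ht]⟩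

theorem TwoCut.apart (hm : 4 ≤ m)
    (hK : m ≤ 4 → ∀ p q r s, ¬ (G.Adj p q ∧ G.Adj p r ∧ G.Adj p s ∧ G.Adj q r ∧ G.Adj q s ∧
      G.Adj r s)) (h : TwoCut G W C D a b) (hC : Flexible G m C)
    (hD : Flexible G m D) {x s t : V} (hx : x ∈ W) (hs : s ∈ W) (ht : t ∈ W) (hxs : x ≠ s)
    (hxt : x ≠ t) : ∃ c : V → Fin m, ProperOn G W c ∧ c x ≠ c s ∧ c x ≠ c t := by
  have side : ∀ {C D : Finset V}, TwoCut G W C D a b → Flexible G m C → Flexible G m D →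
      x ∈ C → s ∈ C → t ∈ C →
      ∃ c : V → Fin m, ProperOn G W c ∧ c x ≠ c s ∧ c x ≠ c t := by
    intro C D h hC hD hx hs ht
    obtain ⟨c₁, h₁, h₁s, h₁t⟩ := hC.apart x hx s hs t ht hxs hxt
    obtain ⟨c, hc, hC'⟩ := h.extend hD h₁
    exact ⟨c, hc, by rwa [hC' x hx, hC' s hs], by rwa [hC' x hx, hC' t ht]⟩
  have split : ∀ {C D : Finset V}, TwoCut G W C D a b → Flexible G m C → Flexible G m D →
      x ∈ C → ∃ c : V → Fin m, ProperOn G W c ∧ c x ≠ c s ∧ c x ≠ c t := by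
    intro C D h hC hD hxC
    by_cases hxD : x ∈ D
    · have mixed : ∀ {s t : V}, x ≠ s → x ≠ t → s ∈ C → t ∈ D →
          ∃ c : V → Fin m, ProperOn G W c ∧ c x ≠ c s ∧ c x ≠ c t := by
        intro s t hxs hxt hs ht
        rcases h.inter x hxC hxD with rfl | rfl
        · exact h.apart_of_eq hC hD hs ht hxs hxt
        · exact h.swap.apart_of_eq hC hD hs ht hxs hxt
      rcases h.cover s hs with hs | hs
      · rcases h.cover t ht with ht | ht
        · exact side h hC hD hxC hs ht
        · exact mixed hxs hxt hs ht
      · rcases h.cover t ht with ht | ht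
        · obtain ⟨c, hc, h1, h2⟩ := mixed hxt hxs ht hs
          exact ⟨c, hc, h2, h1⟩
        · exact side h.symm hD hC hxD hs ht
    · rcases h.cover s hs with hs | hs
      · rcases h.cover t ht with ht | ht
        · exact side h hC hD hxC hs ht
        · exact h.apart_mixed hm hC hD hxC hxD hs ht hxs
      · rcases h.cover t ht with ht | ht
        · obtain ⟨c, hc, h1, h2⟩ := h.apart_mixed hm hC hD hxC hxD ht hs hxt
          exact ⟨c, hc, h2, h1⟩
        · exact h.apart_opposite hm hK hC hD hxC hxD hs ht
  rcases h.cover x hx with hx | hx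
  · exact split h hC hD hx
  · exact split h.symm hD hC hx

theorem TwoCut.glue_equal (h : TwoCut G W C D a b) {c₁ c₂ : V → Fin m}
    (h₁ : ProperOn G C c₁) (h₂ : ProperOn G D c₂) (hab : c₁ a = c₁ b ↔ c₂ a = c₂ b) {x y : V}
    (hx : x ∈ C) (hy : y ∈ D) (hxa : c₁ x = c₁ a ↔ c₂ y = c₂ a)
    (hxb : c₁ x = c₁ b ↔ c₂ y = c₂ b) :
    ∃ c : V → Fin m, ProperOn G W c ∧ (∀ v ∈ C, c v = c₁ v) ∧ c x = c y := by
  obtain ⟨c, hc, hC', hy', -⟩ := h.glue h₁ h₂ hab hy (c₁ x) hxa hxb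
  exact ⟨c, hc, hC', by rw [hC' x hx, hy']⟩

theorem TwoCut.equal_opposite (h : TwoCut G W C D a b) (hC : Flexible G m C)
    (hD : Flexible G m D) {x y : V} (hx : x ∈ C) (hx' : x ∉ D) (hy : y ∈ D) (hy' : y ∉ C)
    {c₁ c₂ : V → Fin m} (h₁ : ProperOn G C c₁) (h₂ : ProperOn G D c₂) (h₁a : c₁ x ≠ c₁ a)
    (h₁b : c₁ x ≠ c₁ b) (h₂a : c₂ y ≠ c₂ a) (e₁ : c₁ a ≠ c₁ b) (e₂ : c₂ a = c₂ b) :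
    ∃ c : V → Fin m, ProperOn G W c ∧ c x = c y := by
  have hxa : x ≠ a := fun e => hx' (e ▸ h.aD)
  have hxb : x ≠ b := fun e => hx' (e ▸ h.bD)
  have hya : y ≠ a := fun e => hy' (e ▸ h.aC)
  have hyb : y ≠ b := fun e => hy' (e ▸ h.bC)
  have hadj : ¬ G.Adj a b := fun e => h₂ a h.aD b h.bD e e₂
  have fin : ∀ {c₁ c₂ : V → Fin m}, ProperOn G C c₁ → ProperOn G D c₂ →
      (c₁ a = c₁ b ↔ c₂ a = c₂ b) → (c₁ x = c₁ a ↔ c₂ y = c₂ a) →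
      (c₁ x = c₁ b ↔ c₂ y = c₂ b) → ∃ c : V → Fin m, ProperOn G W c ∧ c x = c y := by
    intro c₁ c₂ h₁ h₂ hab h3 h4
    obtain ⟨c, hc, -, e⟩ := h.glue_equal h₁ h₂ hab hx hy h3 h4
    exact ⟨c, hc, e⟩
  obtain ⟨c₃, h₃, hnot, htwo⟩ := hC.two x hx a h.aC b h.bC hxa hxb h.ne (fun e => hadj e.2.1)
  by_cases e₃ : c₃ a = c₃ b
  · exact fin h₃ h₂ (by grind) (by grind) (by grind)
  by_cases e₄ : c₃ x = c₃ a
  · obtain ⟨c₄, h₄, h₄a, h₄y⟩ := hD.apart b h.bD a h.aD y hy h.ne.symm hyb.symm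
    by_cases e₅ : c₄ y = c₄ a
    · exact fin h₃ h₄ (by grind) (by grind) (by grind)
    · exact fin h₁ h₄ (by grind) (by grind) (by grind)
  · obtain ⟨c₄, h₄, h₄b, h₄y⟩ := hD.apart a h.aD b h.bD y hy h.ne hya.symm
    by_cases e₅ : c₄ y = c₄ b
    · exact fin h₃ h₄ (by grind) (by grind) (by grind)
    · exact fin h₁ h₄ (by grind) (by grind) (by grind)

theorem TwoCut.equal (h : TwoCut G W C D a b) (hC : Flexible G m C)
    (hD : Flexible G m D) {x y : V} (hx : x ∈ W) (hy : y ∈ W) (hxy : x ≠ y)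
    (hadj : ¬ G.Adj x y) : ∃ c : V → Fin m, ProperOn G W c ∧ c x = c y := by
  have side : ∀ {C D : Finset V}, TwoCut G W C D a b → Flexible G m C → Flexible G m D →
      x ∈ C → y ∈ C → ∃ c : V → Fin m, ProperOn G W c ∧ c x = c y := by
    intro C D h hC hD hx hy
    obtain ⟨c₁, h₁, e⟩ := hC.equal x hx y hy hxy hadj
    obtain ⟨c, hc, hC'⟩ := h.extend hD h₁
    exact ⟨c, hc, by rwa [hC' x hx, hC' y hy]⟩
  have cross : ∀ {x y : V}, x ∈ C → x ∉ D → y ∈ D → y ∉ C →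
      ∃ c : V → Fin m, ProperOn G W c ∧ c x = c y := by
    intro x y hxC hxD hyD hyC
    obtain ⟨c₁, h₁, h₁a, h₁b⟩ := hC.apart x hxC a h.aC b h.bC (fun e => hxD (e ▸ h.aD))
      (fun e => hxD (e ▸ h.bD))
    obtain ⟨c₂, h₂, h₂a, h₂b⟩ := hD.apart y hyD a h.aD b h.bD (fun e => hyC (e ▸ h.aC))
      (fun e => hyC (e ▸ h.bC))
    by_cases e₁ : c₁ a = c₁ b
    · by_cases e₂ : c₂ a = c₂ b
      · obtain ⟨c, hc, -, e⟩ := h.glue_equal h₁ h₂ (by grind) hxC hyD (by grind) (by grind)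
        exact ⟨c, hc, e⟩
      · obtain ⟨c, hc, e⟩ := h.symm.equal_opposite hD hC hyD hyC hxC hxD h₂ h₁ h₂a h₂b h₁a e₂ e₁
        exact ⟨c, hc, e.symm⟩
    · by_cases e₂ : c₂ a = c₂ b
      · exact h.equal_opposite hC hD hxC hxD hyD hyC h₁ h₂ h₁a h₁b h₂a e₁ e₂
      · obtain ⟨c, hc, -, e⟩ := h.glue_equal h₁ h₂ (by grind) hxC hyD (by grind) (by grind)
        exact ⟨c, hc, e⟩
  by_cases hxC : x ∈ C
  · by_cases hyC : y ∈ C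
    · exact side h hC hD hxC hyC
    · have hyD := (h.cover y hy).resolve_left hyC
      by_cases hxD : x ∈ D
      · exact side h.symm hD hC hxD hyD
      · exact cross hxC hxD hyD hyC
  · have hxD := (h.cover x hx).resolve_left hxC
    by_cases hyD : y ∈ D
    · exact side h.symm hD hC hxD hyD
    · have hyC := (h.cover y hy).resolve_right hyD
      obtain ⟨c, hc, e⟩ := cross hyC hyD hxD hxC
      exact ⟨c, hc, e.symm⟩

theorem TwoCut.escape_opposite (hm : 4 ≤ m)
    (hK : m ≤ 4 → ∀ p q r s, ¬ (G.Adj p q ∧ G.Adj p r ∧ G.Adj p s ∧ G.Adj q r ∧ G.Adj q s ∧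
      G.Adj r s)) (h : TwoCut G W C D a b) (hC : Flexible G m C)
    (hD : Flexible G m D) {x z s t : V} (hx : x ∈ C) (hx' : x ∉ D) (hz : z ∈ C) (hs : s ∈ D)
    (ht : t ∈ D) (hxz : G.Adj x z) :
    ∃ c : V → Fin m, ProperOn G W c ∧
      ((c x ≠ c s ∧ c x ≠ c t) ∨ (c z ≠ c s ∧ c z ≠ c t)) := by
  by_cases hadj : G.Adj a b
  · obtain ⟨c₁, h₁, h₁a, h₁b⟩ := hC.apart x hx a h.aC b h.bC (fun e => hx' (e ▸ h.aD))
      (fun e => hx' (e ▸ h.bD))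
    obtain ⟨c₂, d, h₂, da, db, ds, dt⟩ := hD.exists_fresh hm hK h.aD h.bD hs ht h.ne
    obtain ⟨c, hc, hD', hcx⟩ := h.glue_avoid h₁ h₂
      (by simp [h₁ a h.aC b h.bC hadj, h₂ a h.aD b h.bD hadj]) hx h₁a h₁b da db
    exact ⟨c, hc, Or.inl ⟨by rwa [hcx, hD' s hs], by rwa [hcx, hD' t ht]⟩⟩
  obtain ⟨c₁, h₁, e₁⟩ := hC.equal a h.aC b h.bC h.ne hadj
  obtain ⟨c₂, h₂, e₂⟩ := hD.equal a h.aD b h.bD h.ne hadj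
  obtain ⟨d, da, ds, dt⟩ := exists_fresh_three hm (c₂ a) (c₂ s) (c₂ t)
  have aux : ∀ w ∈ C, c₁ w ≠ c₁ a → ∃ c : V → Fin m, ProperOn G W c ∧ c w ≠ c s ∧ c w ≠ c t := by
    intro w hw hwa
    obtain ⟨c, hc, hD', hcw⟩ := h.glue_avoid h₁ h₂ (by simp [e₁, e₂]) hw hwa (e₁ ▸ hwa) da
      (e₂ ▸ da)
    exact ⟨c, hc, by rwa [hcw, hD' s hs], by rwa [hcw, hD' t ht]⟩
  by_cases hxa : c₁ x = c₁ a
  · obtain ⟨c, hc, e⟩ := aux z hz fun hza => h₁ x hx z hz hxz (hxa.trans hza.symm)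
    exact ⟨c, hc, Or.inr e⟩
  · obtain ⟨c, hc, e⟩ := aux x hx hxa
    exact ⟨c, hc, Or.inl e⟩

theorem TwoCut.edge_mem (h : TwoCut G W C D a b) {x z : V} (hx : x ∈ W) (hz : z ∈ W)
    (hxz : G.Adj x z) : (x ∈ C ∧ z ∈ C) ∨ (x ∈ D ∧ z ∈ D) := by
  have h1 := h.cover x hx
  have h2 := h.cover z hz
  have h3 := h.noEdge x
  have h4 := h.noEdge z
  have h5 := hxz.symm
  grind

theorem TwoCut.escape (hm : 4 ≤ m)
    (hK : m ≤ 4 → ∀ p q r s, ¬ (G.Adj p q ∧ G.Adj p r ∧ G.Adj p s ∧ G.Adj q r ∧ G.Adj q s ∧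
      G.Adj r s)) (h : TwoCut G W C D a b) (hC : Flexible G m C)
    (hD : Flexible G m D) {x z s t : V} (hx : x ∈ W) (hz : z ∈ W) (hs : s ∈ W) (ht : t ∈ W)
    (hxs : x ≠ s) (hxt : x ≠ t) (hzs : z ≠ s) (hzt : z ≠ t)
    (hxz : G.Adj x z) (hst : G.Adj s t) :
    ∃ c : V → Fin m, ProperOn G W c ∧
      ((c x ≠ c s ∧ c x ≠ c t) ∨ (c z ≠ c s ∧ c z ≠ c t)) := by
  have side : ∀ {C D : Finset V}, TwoCut G W C D a b → Flexible G m C → Flexible G m D →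
      x ∈ C → z ∈ C → s ∈ C → t ∈ C → ∃ c : V → Fin m, ProperOn G W c ∧
      ((c x ≠ c s ∧ c x ≠ c t) ∨ (c z ≠ c s ∧ c z ≠ c t)) := by
    intro C D h hC hD hx hz hs ht
    obtain ⟨c₁, h₁, e⟩ := hC.escape x hx z hz s hs t ht hxs hxt hzs hzt hxz hst
    obtain ⟨c, hc, hC'⟩ := h.extend hD h₁
    exact ⟨c, hc, by rwa [hC' x hx, hC' z hz, hC' s hs, hC' t ht]⟩
  have cross : ∀ {C D : Finset V}, TwoCut G W C D a b → Flexible G m C → Flexible G m D →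
      x ∈ C → z ∈ C → s ∈ D → t ∈ D → ∃ c : V → Fin m, ProperOn G W c ∧
      ((c x ≠ c s ∧ c x ≠ c t) ∨ (c z ≠ c s ∧ c z ≠ c t)) := by
    intro C D h hC hD hx hz hs ht
    by_cases hxD : x ∈ D
    · by_cases hzD : z ∈ D
      · exact side h.symm hD hC hxD hzD hs ht
      · obtain ⟨c, hc, e⟩ := h.escape_opposite hm hK hC hD hz hzD hx hs ht hxz.symm
        exact ⟨c, hc, e.symm⟩
    · exact h.escape_opposite hm hK hC hD hx hxD hz hs ht hxz
  rcases h.edge_mem hx hz hxz with ⟨h1, h2⟩ | ⟨h1, h2⟩ <;>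
    rcases h.edge_mem hs ht hst with ⟨h3, h4⟩ | ⟨h3, h4⟩
  · exact side h hC hD h1 h2 h3 h4
  · exact cross h hC hD h1 h2 h3 h4
  · exact cross h.symm hD hC h1 h2 h3 h4
  · exact side h.symm hD hC h1 h2 h3 h4

theorem TwoCut.two_of_mem_inter (h : TwoCut G W C D a b) (hC : Flexible G m C)
    (hD : Flexible G m D) {x y : V} (hx : x ∈ C) (hx' : x ∉ D) (hy : y ∈ D) (hy' : y ∉ C) :
    ∃ c : V → Fin m, ProperOn G W c ∧ ExactlyTwo (c x) (c y) (c a) := by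
  obtain ⟨c₁, h₁, h₁a, h₁b⟩ := hC.apart x hx a h.aC b h.bC (fun e => hx' (e ▸ h.aD))
    (fun e => hx' (e ▸ h.bD))
  obtain ⟨c₂, h₂, h₂a, h₂b⟩ := hD.apart y hy a h.aD b h.bD (fun e => hy' (e ▸ h.aC))
    (fun e => hy' (e ▸ h.bC))
  by_cases e : c₁ a = c₁ b ↔ c₂ a = c₂ b
  · obtain ⟨c, hc, hC', e⟩ := h.glue_equal h₁ h₂ e hx hy (by grind) (by grind)
    have := hC' x hx
    have := hC' a h.aC
    exact ⟨c, hc, by grind, by grind⟩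
  have same : ∀ {C D : Finset V} {x y : V} {c₂ : V → Fin m}, TwoCut G W C D a b →
      Flexible G m C → x ∈ C → y ∈ D → ProperOn G D c₂ → c₂ y ≠ c₂ a → c₂ a = c₂ b →
      ∃ c : V → Fin m, ProperOn G W c ∧ ExactlyTwo (c x) (c y) (c a) := by
    intro C D x y c₂ h hC hx hy h₂ h₂a e₂
    obtain ⟨c₃, h₃, e₃⟩ := hC.equal a h.aC b h.bC h.ne fun e => h₂ a h.aD b h.bD e e₂
    by_cases e₄ : c₃ x = c₃ a
    · obtain ⟨c, hc, hC', hD'⟩ := h.glue' h₃ h₂ (by grind)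
      have := hC' x hx
      have := hC' a h.aC
      have := hD' y hy a h.aD
      exact ⟨c, hc, by grind, by grind⟩
    · obtain ⟨c, hc, hC', e⟩ := h.glue_equal h₃ h₂ (by grind) hx hy (by grind) (by grind)
      have := hC' x hx
      have := hC' a h.aC
      exact ⟨c, hc, by grind, by grind⟩
  by_cases e₂ : c₂ a = c₂ b
  · exact same h hC hx hy h₂ h₂a e₂
  · obtain ⟨c, hc, hn, ht⟩ := same h.symm hD hy hx h₁ h₁a (by grind)
    exact ⟨c, hc, by grind, by grind⟩

theorem TwoCut.two_of_avoid (hm : 4 ≤ m) (h : TwoCut G W C D a b) {x y z : V}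
    (hx : x ∈ C) (hz : z ∈ C) (hy : y ∈ D) {c₁ c₂ : V → Fin m} (h₁ : ProperOn G C c₁)
    (h₂ : ProperOn G D c₂) (hab : c₁ a = c₁ b ↔ c₂ a = c₂ b) (hya : c₂ y ≠ c₂ a)
    (hyb : c₂ y ≠ c₂ b)
    (hxz : c₁ x = c₁ z ∨ (c₁ x ≠ c₁ a ∧ c₁ x ≠ c₁ b) ∨ (c₁ z ≠ c₁ a ∧ c₁ z ≠ c₁ b)) :
    ∃ c : V → Fin m, ProperOn G W c ∧ ExactlyTwo (c x) (c y) (c z) := by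
  obtain ⟨q, qa, qb, hq⟩ : ∃ q, q ≠ c₁ a ∧ q ≠ c₁ b ∧ ExactlyTwo (c₁ x) q (c₁ z) := by
    by_cases e : c₁ x = c₁ z
    · obtain ⟨d, da, db, dx⟩ := exists_fresh_three hm (c₁ a) (c₁ b) (c₁ x)
      exact ⟨d, da, db, by grind, by grind⟩
    · rcases hxz with e' | e' | e'
      · exact absurd e' e
      · exact ⟨c₁ x, e'.1, e'.2, by grind, by grind⟩
      · exact ⟨c₁ z, e'.1, e'.2, by grind, by grind⟩
  obtain ⟨c, hc, hC', hy', -⟩ := h.glue h₁ h₂ hab hy q (by simp [qa, hya]) (by simp [qb, hyb])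
  exact ⟨c, hc, by rwa [hC' x hx, hC' z hz, hy']⟩

theorem TwoCut.two_opposite (hm : 4 ≤ m) (h : TwoCut G W C D a b) (hC : Flexible G m C)
    (hD : Flexible G m D) {x y z : V} (hx : x ∈ C) (hx' : x ∉ D) (hz : z ∈ C) (hz' : z ∉ D)
    (hy : y ∈ D) (hy' : y ∉ C) (hxz : x ≠ z) :
    ∃ c : V → Fin m, ProperOn G W c ∧ ExactlyTwo (c x) (c y) (c z) := by
  have hxa : x ≠ a := fun e => hx' (e ▸ h.aD)
  have hxb : x ≠ b := fun e => hx' (e ▸ h.bD)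
  have hza : z ≠ a := fun e => hz' (e ▸ h.aD)
  have hzb : z ≠ b := fun e => hz' (e ▸ h.bD)
  have hya : y ≠ a := fun e => hy' (e ▸ h.aC)
  have hyb : y ≠ b := fun e => hy' (e ▸ h.bC)
  obtain ⟨c₂, h₂, h₂a, h₂b⟩ := hD.apart y hy a h.aD b h.bD hya hyb
  by_cases hadj : G.Adj a b
  · obtain ⟨c₁, h₁, e⟩ : ∃ c₁ : V → Fin m, ProperOn G C c₁ ∧ (c₁ x = c₁ z ∨
        (c₁ x ≠ c₁ a ∧ c₁ x ≠ c₁ b) ∨ (c₁ z ≠ c₁ a ∧ c₁ z ≠ c₁ b)) := by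
      by_cases hadj' : G.Adj x z
      · obtain ⟨c₁, h₁, e⟩ :=
          hC.escape x hx z hz a h.aC b h.bC hxa hxb hza hzb hadj' hadj
        exact ⟨c₁, h₁, Or.inr e⟩
      · obtain ⟨c₁, h₁, e⟩ := hC.equal x hx z hz hxz hadj'
        exact ⟨c₁, h₁, Or.inl e⟩
    exact h.two_of_avoid hm hx hz hy h₁ h₂
      (by simp [h₁ a h.aC b h.bC hadj, h₂ a h.aD b h.bD hadj]) h₂a h₂b e
  have same : ∀ {c₂ : V → Fin m}, ProperOn G D c₂ → c₂ y ≠ c₂ a → c₂ a = c₂ b →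
      ∃ c : V → Fin m, ProperOn G W c ∧ ExactlyTwo (c x) (c y) (c z) := by
    intro c₂ h₂ h₂a e₂
    obtain ⟨c₁, h₁, e₁⟩ := hC.equal a h.aC b h.bC h.ne hadj
    exact h.two_of_avoid hm hx hz hy h₁ h₂ (by simp [e₁, e₂]) h₂a (e₂ ▸ h₂a) (by grind)
  by_cases e₂ : c₂ a = c₂ b
  · exact same h₂ h₂a e₂
  obtain ⟨c₃, h₃, hnot, htwo⟩ := hD.two y hy a h.aD b h.bD hya hyb h.ne (fun e => hadj e.2.1)
  by_cases e₃ : c₃ a = c₃ b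
  · exact same h₃ (by grind) e₃
  obtain ⟨c₁, h₁, e₁, -⟩ := hC.apart a h.aC b h.bC b h.bC h.ne h.ne
  by_cases e : c₁ x = c₁ z ∨ (c₁ x ≠ c₁ a ∧ c₁ x ≠ c₁ b) ∨ (c₁ z ≠ c₁ a ∧ c₁ z ≠ c₁ b)
  · exact h.two_of_avoid hm hx hz hy h₁ h₂ (by simp [e₁, e₂]) h₂a h₂b e
  obtain ⟨c, hc, hC', hD'⟩ := h.glue' h₁ h₃ (by simp [e₁, e₃])
  have h1 := hC' a h.aC
  have h2 := hC' b h.bC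
  have h3 := hC' x hx
  have h4 := hC' z hz
  have h5 := hD' y hy a h.aD
  have h6 := hD' y hy b h.bD
  exact ⟨c, hc, by grind, by grind⟩

theorem TwoCut.two (hm : 4 ≤ m) (h : TwoCut G W C D a b) (hC : Flexible G m C)
    (hD : Flexible G m D) {x y z : V} (hx : x ∈ W) (hy : y ∈ W) (hz : z ∈ W) (hxy : x ≠ y)
    (hxz : x ≠ z) (hyz : y ≠ z) (hadj : ¬ (G.Adj x y ∧ G.Adj y z ∧ G.Adj x z)) :
    ∃ c : V → Fin m, ProperOn G W c ∧ ExactlyTwo (c x) (c y) (c z) := by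
  have side : ∀ {C D : Finset V}, TwoCut G W C D a b → Flexible G m C → Flexible G m D →
      x ∈ C → y ∈ C → z ∈ C →
      ∃ c : V → Fin m, ProperOn G W c ∧ ExactlyTwo (c x) (c y) (c z) := by
    intro C D h hC hD hx hy hz
    obtain ⟨c₁, h₁, e⟩ := hC.two x hx y hy z hz hxy hxz hyz hadj
    obtain ⟨c, hc, hC'⟩ := h.extend hD h₁
    exact ⟨c, hc, by rwa [hC' x hx, hC' y hy, hC' z hz]⟩
  have core : ∀ {C D : Finset V}, TwoCut G W C D a b → Flexible G m C → Flexible G m D →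
      ∀ {x y z : V}, x ≠ z → x ∈ C → x ∉ D → y ∈ D → y ∉ C → z ∈ C →
      ∃ c : V → Fin m, ProperOn G W c ∧ ExactlyTwo (c x) (c y) (c z) := by
    intro C D h hC hD x y z hxz hx hx' hy hy' hz
    by_cases hz' : z ∈ D
    · rcases h.inter z hz hz' with rfl | rfl
      · exact h.two_of_mem_inter hC hD hx hx' hy hy'
      · exact h.swap.two_of_mem_inter hC hD hx hx' hy hy'
    · exact h.two_opposite hm hC hD hx hx' hz hz' hy hy' hxz
  have cross : ∀ {x y z : V}, x ≠ z → y ≠ z → z ∈ W → x ∈ C → x ∉ D → y ∈ D → y ∉ C →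
      ∃ c : V → Fin m, ProperOn G W c ∧ ExactlyTwo (c x) (c y) (c z) := by
    intro x y z hxz hyz hz hx hx' hy hy'
    rcases h.cover z hz with hz | hz
    · exact core h hC hD hxz hx hx' hy hy' hz
    · obtain ⟨c, hc, h1, h2⟩ := core h.symm hD hC hyz hy hy' hx hx' hz
      exact ⟨c, hc, by grind, by grind⟩
  by_cases h1 : x ∈ C ∧ y ∈ C ∧ z ∈ C
  · exact side h hC hD h1.1 h1.2.1 h1.2.2
  by_cases h2 : x ∈ D ∧ y ∈ D ∧ z ∈ D
  · exact side h.symm hD hC h2.1 h2.2.1 h2.2.2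
  obtain ⟨p, q, r, hp, hp', hq, hq', hr, hpr, hqr, hperm⟩ : ∃ p q r, p ∈ C ∧ p ∉ D ∧ q ∈ D ∧
      q ∉ C ∧ r ∈ W ∧ p ≠ r ∧ q ≠ r ∧ ∀ c : V → Fin m, ExactlyTwo (c p) (c q) (c r) →
        ExactlyTwo (c x) (c y) (c z) := by
    have p1 : ∀ c : V → Fin m, ExactlyTwo (c x) (c z) (c y) → ExactlyTwo (c x) (c y) (c z) :=
      fun c => by unfold ExactlyTwo; grind
    have p2 : ∀ c : V → Fin m, ExactlyTwo (c y) (c x) (c z) → ExactlyTwo (c x) (c y) (c z) :=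
      fun c => by unfold ExactlyTwo; grind
    have p3 : ∀ c : V → Fin m, ExactlyTwo (c y) (c z) (c x) → ExactlyTwo (c x) (c y) (c z) :=
      fun c => by unfold ExactlyTwo; grind
    have p4 : ∀ c : V → Fin m, ExactlyTwo (c z) (c x) (c y) → ExactlyTwo (c x) (c y) (c z) :=
      fun c => by unfold ExactlyTwo; grind
    have p5 : ∀ c : V → Fin m, ExactlyTwo (c z) (c y) (c x) → ExactlyTwo (c x) (c y) (c z) :=
      fun c => by unfold ExactlyTwo; grind
    have kx := h.cover x hx
    have ky := h.cover y hy
    have kz := h.cover z hz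
    by_cases xC : x ∈ C
    · by_cases yC : y ∈ C
      · have zC : z ∉ C := by grind only
        have zD : z ∈ D := by grind only
        by_cases xD : x ∈ D
        · have yD : y ∉ D := by grind only
          exact ⟨y, z, x, yC, yD, zD, zC, hx, hxy.symm, hxz.symm, p3⟩
        · exact ⟨x, z, y, xC, xD, zD, zC, hy, hxy, hyz.symm, p1⟩
      · have yD : y ∈ D := by grind only
        by_cases xD : x ∈ D
        · have zD : z ∉ D := by grind only
          have zC : z ∈ C := by grind only
          exact ⟨z, y, x, zC, zD, yD, yC, hx, hxz.symm, hxy.symm, p5⟩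
        · exact ⟨x, y, z, xC, xD, yD, yC, hz, hxz, hyz, fun _ e => e⟩
    · have xD : x ∈ D := by grind only
      by_cases yD : y ∈ D
      · have zD : z ∉ D := by grind only
        have zC : z ∈ C := by grind only
        exact ⟨z, x, y, zC, zD, xD, xC, hy, hyz.symm, hxy, p4⟩
      · have yC : y ∈ C := by grind only
        exact ⟨y, x, z, yC, yD, xD, xC, hz, hyz, hxz, p2⟩
  obtain ⟨c, hc, e⟩ := cross hpr hqr hr hp hp' hq hq'
  exact ⟨c, hc, hperm c e⟩

end Steps

/-- A graph whose vertices can be coloured without using the colour `ω` is flexible. -/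
theorem flexible_of_missing_colour {V : Type*} {G : SimpleGraph V} {m : ℕ} {W : Finset V}
    {c : V → Fin m} {ω : Fin m} (hc : ProperOn G W c) (hω : ∀ v ∈ W, c v ≠ ω) :
    Flexible G m W := by
  classical
  have recolour : ∀ x y, ¬ G.Adj x y →
      ProperOn G W (fun v => if v = x ∨ v = y then ω else c v) := by
    intro x y hxy u hu v hv e
    have h1 := hc u hu v hv e
    have h2 := hω u hu
    have h3 := hω v hv
    have h4 := e.symm
    have h5 := e.ne
    grind
  have equal : ∀ x ∈ W, ∀ y ∈ W, ∀ z ∈ W, x ≠ z → y ≠ z → ¬ G.Adj x y →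
      ∃ c : V → Fin m, ProperOn G W c ∧ c x = c y ∧ c x ≠ c z := by
    intro x hx y hy z hz hxz hyz hxy
    exact ⟨_, recolour x y hxy, by simp, by simp [hxz.symm, hyz.symm, (hω z hz).symm]⟩
  have apart : ∀ x ∈ W, ∀ s ∈ W, ∀ t ∈ W, x ≠ s → x ≠ t →
      ∃ c : V → Fin m, ProperOn G W c ∧ c x ≠ c s ∧ c x ≠ c t := by
    intro x hx s hs t ht hxs hxt
    exact ⟨_, recolour x x (by simp), by simp [hxs.symm, (hω s hs).symm],
      by simp [hxt.symm, (hω t ht).symm]⟩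
  refine ⟨?_, apart, ?_, ?_⟩
  · intro x hx y hy z hz hxy hxz hyz h
    by_cases h1 : G.Adj x y
    · by_cases h2 : G.Adj y z
      · obtain ⟨c, hc, e, e'⟩ := equal x hx z hz y hy hxy hyz.symm fun h3 => h ⟨h1, h2, h3⟩
        exact ⟨c, hc, by grind, by grind⟩
      · obtain ⟨c, hc, e, e'⟩ := equal y hy z hz x hx hxy.symm hxz.symm h2
        exact ⟨c, hc, by grind, by grind⟩
    · obtain ⟨c, hc, e, e'⟩ := equal x hx y hy z hz hxz hyz h1
      exact ⟨c, hc, by grind, by grind⟩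
  · intro x hx y hy hxy hadj
    exact ⟨_, recolour x y hadj, by simp⟩
  · intro x hx z hz s hs t ht hxs hxt _ _ _ _
    obtain ⟨c, hc, e⟩ := apart x hx s hs t ht hxs hxt
    exact ⟨c, hc, Or.inl e⟩

/-- In an `m`-fragile graph, every vertex set either can be coloured without one of the `m`
colours, or has a two-vertex cut. -/
theorem missing_colour_or_twoCut {V : Type*} {G : SimpleGraph V} {m : ℕ} (hm : 4 ≤ m)
    (hG : G.MFragile m) (W : Finset V) :
    (∃ (c : V → Fin m) (ω : Fin m), ProperOn G W c ∧ ∀ v ∈ W, c v ≠ ω) ∨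
      ∃ C D a b, TwoCut G W C D a b ∧ (∃ u ∈ W, u ∉ D) ∧ ∃ v ∈ W, v ∉ C := by
  classical
  have lift : ∀ {k : ℕ} (f : ↥(W : Set V) → Fin k), k < m →
      (∀ u v : ↥(W : Set V), G.Adj u v → f u ≠ f v) →
      ∃ (c : V → Fin m) (ω : Fin m), ProperOn G W c ∧ ∀ v ∈ W, c v ≠ ω := by
    intro k f hk hf
    refine ⟨fun v => if h : v ∈ W then ⟨f ⟨v, h⟩, (f ⟨v, h⟩).isLt.trans hk⟩ else ⟨k, hk⟩,
      ⟨k, hk⟩, fun u hu v hv e => ?_, fun v hv => ?_⟩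
    · have := hf ⟨u, hu⟩ ⟨v, hv⟩ e
      simpa [hu, hv, Fin.ext_iff] using this
    · have := (f ⟨v, hv⟩).isLt
      simp [hv, this.ne]
  by_cases hW : W.card < m
  · exact Or.inl (lift (fun v => W.equivFin v) hW fun u v e h => e.ne (by simpa using h))
  by_cases hK : ((⊤ : G.Subgraph).induce (W : Set V)).coe.IsKConnected 3
  · obtain ⟨f⟩ := hG _ hK
    exact Or.inl (lift f (by omega) fun u v e => f.valid (by simpa using ⟨u.2, v.2, e⟩))
  right
  have hcard : Nat.card ((⊤ : G.Subgraph).induce (W : Set V)).verts = W.card := by simp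
  obtain ⟨S, hS, hconn⟩ : ∃ S : Set ((⊤ : G.Subgraph).induce (W : Set V)).verts, S.ncard ≤ 2 ∧
      ¬ (((⊤ : G.Subgraph).induce (W : Set V)).coe.induce Sᶜ).Connected := by
    by_contra! h
    exact hK ⟨by rw [hcard]; omega, h⟩
  have hfin : Finite ((⊤ : G.Subgraph).induce (W : Set V)).verts :=
    Nat.finite_of_card_ne_zero (by rw [hcard]; omega)
  have hne : Nonempty (Sᶜ : Set _) := by
    rw [Set.nonempty_coe_sort, Set.nonempty_iff_ne_empty, Ne, Set.compl_empty_iff]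
    rintro rfl
    rw [Set.ncard_univ, hcard] at hS
    omega
  obtain ⟨u, v, huv⟩ : ∃ u v : (Sᶜ : Set _),
      ¬ (((⊤ : G.Subgraph).induce (W : Set V)).coe.induce Sᶜ).Reachable u v := by
    by_contra! h
    exact hconn ⟨h⟩
  have huW : u.1.1 ∈ W := u.1.2
  have hvW : v.1.1 ∈ W := v.1.2
  have hne' : u.1.1 ≠ v.1.1 := fun e => huv (Subtype.ext (Subtype.ext e) ▸ .refl _)
  have hpair : ((W.erase u.1.1).erase v.1.1).card + 2 = W.card := by
    rw [Finset.card_erase_of_mem (by simp [hne'.symm, hvW]), Finset.card_erase_of_mem huW]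
    omega
  obtain ⟨T, hST, hTW, hT⟩ : ∃ T, S.toFinite.toFinset.image Subtype.val ⊆ T ∧
      T ⊆ (W.erase u.1.1).erase v.1.1 ∧ T.card = 2 := by
    refine Finset.exists_subsuperset_card_eq (fun w hw => ?_) ?_ (by omega)
    · obtain ⟨w, hwS, rfl⟩ := Finset.mem_image.mp hw
      rw [Set.Finite.mem_toFinset] at hwS
      have hwW : w.1 ∈ W := w.2
      have h1 : w.1 ≠ v.1.1 := fun e => v.2 (Subtype.ext e ▸ hwS)
      have h2 : w.1 ≠ u.1.1 := fun e => u.2 (Subtype.ext e ▸ hwS)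
      simp [h1, h2, hwW]
    · exact Finset.card_image_le.trans (by rwa [← Set.ncard_eq_toFinset_card])
  obtain ⟨a, b, hab, rfl⟩ := Finset.card_eq_two.mp hT
  let X : V → Prop := fun w => ∃ w' : (Sᶜ : Set _), w'.1.1 = w ∧
    (((⊤ : G.Subgraph).induce (W : Set V)).coe.induce Sᶜ).Reachable u w'
  have hXu : X u.1.1 := ⟨u, rfl, .refl _⟩
  have hXv : ¬ X v.1.1 := by
    rintro ⟨w, hw, hr⟩
    exact huv (Subtype.ext (Subtype.ext hw) ▸ hr)
  have hX : ∀ p ∈ W, ∀ q ∈ W, X p → ¬ X q → G.Adj p q → q = a ∨ q = b := by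
    rintro p hp q hq ⟨p', rfl, hr⟩ hXq e
    by_contra hqab
    have hqS : (⟨q, hq⟩ : ((⊤ : G.Subgraph).induce (W : Set V)).verts) ∈ Sᶜ := by
      intro h
      have := hST (Finset.mem_image.mpr ⟨_, (Set.Finite.mem_toFinset _).mpr h, rfl⟩)
      simp at this
      exact hqab this
    refine hXq ⟨⟨_, hqS⟩, rfl, hr.trans (SimpleGraph.Adj.reachable ?_)⟩
    simpa using ⟨hp, hq, e⟩
  clear_value X
  have haW := hTW (Finset.mem_insert_self a {b})
  have hbW := hTW (Finset.mem_insert_of_mem (Finset.mem_singleton_self b))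
  simp only [Finset.mem_erase] at haW hbW
  have huD : u.1.1 ∉ W.filter fun w => ¬ X w ∨ w = a ∨ w = b := by
    simp [hXu, haW.2.1.symm, hbW.2.1.symm]
  have hvC : v.1.1 ∉ W.filter fun w => X w ∨ w = a ∨ w = b := by
    simp [hXv, haW.1.symm, hbW.1.symm]
  refine ⟨W.filter fun w => X w ∨ w = a ∨ w = b, W.filter fun w => ¬ X w ∨ w = a ∨ w = b, a, b,
    ⟨(Finset.ssubset_iff_of_subset (Finset.filter_subset _ _)).mpr ⟨_, hvW, hvC⟩,
      (Finset.ssubset_iff_of_subset (Finset.filter_subset _ _)).mpr ⟨_, huW, huD⟩, hab,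
      by simp [haW], by simp [hbW], by simp [haW], by simp [hbW], ?_, ?_, ?_⟩,
    ⟨_, huW, huD⟩, _, hvW, hvC⟩
  · intro w hw
    by_cases hXw : X w <;> simp [hw, hXw]
  · intro w
    simp only [Finset.mem_filter]
    grind only
  · intro p hp q hq hp' hq' e
    have := hX p (Finset.mem_filter.mp hp).1 q (Finset.mem_filter.mp hq).1
    simp only [Finset.mem_filter] at hp hq hp' hq'
    grind only

theorem not_clique_four {V : Type*} {G : SimpleGraph V} {m : ℕ} (hm : 4 ≤ m)
    (hG : G.MFragile m) (hm' : m ≤ 4) (p q r s : V) :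
    ¬ (G.Adj p q ∧ G.Adj p r ∧ G.Adj p s ∧ G.Adj q r ∧ G.Adj q s ∧ G.Adj r s) := by
  classical
  rintro ⟨pq, pr, ps, qr, qs, rs⟩
  rcases missing_colour_or_twoCut hm hG {p, q, r, s} with ⟨c, ω, hc, hω⟩ | h
  · have h1 := hc p (by simp) q (by simp) pq
    have h2 := hc p (by simp) r (by simp) pr
    have h3 := hc p (by simp) s (by simp) ps
    have h4 := hc q (by simp) r (by simp) qr
    have h5 := hc q (by simp) s (by simp) qs
    have h6 := hc r (by simp) s (by simp) rs
    have g1 := hω p (by simp)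
    have g2 := hω q (by simp)
    have g3 := hω r (by simp)
    have g4 := hω s (by simp)
    have := Finset.card_le_univ ({ω, c p, c q, c r, c s} : Finset (Fin m))
    rw [Finset.card_insert_of_notMem (by simp; tauto),
      Finset.card_insert_of_notMem (by simp; tauto),
      Finset.card_insert_of_notMem (by simp; tauto),
      Finset.card_insert_of_notMem (by simp; tauto)] at this
    simp at this
    omega
  · obtain ⟨C, D, a, b, h, ⟨u, hu, huD⟩, v, hv, hvC⟩ := h
    have huC := (h.cover u hu).resolve_right huD
    have hvD := (h.cover v hv).resolve_left hvC
    have huv : u ≠ v := fun e => huD (e ▸ hvD)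
    have hno := h.noEdge u huC v hvD huD hvC
    simp only [Finset.mem_insert, Finset.mem_singleton] at hu hv
    have := pq.symm
    have := pr.symm
    have := ps.symm
    have := qr.symm
    have := qs.symm
    have := rs.symm
    grind

theorem flexible {V : Type*} {G : SimpleGraph V} {m : ℕ} (hm : 4 ≤ m)
    (hG : G.MFragile m) (W : Finset V) : Flexible G m W := by
  classical
  induction W using Finset.strongInduction with
  | H W ih =>
    rcases missing_colour_or_twoCut hm hG W with ⟨c, ω, hc, hω⟩ | ⟨C, D, a, b, h, -, -⟩
    · exact flexible_of_missing_colour hc hω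
    have hC := ih C h.left
    have hD := ih D h.right
    have hK := not_clique_four hm hG
    exact ⟨fun x hx y hy z hz => h.two hm hC hD hx hy hz,
      fun x hx s hs t ht => h.apart hm hK hC hD hx hs ht,
      fun x hx y hy => h.equal hC hD hx hy,
      fun x hx z hz s hs t ht => h.escape hm hK hC hD hx hz hs ht⟩

end FragileColouring

/-- Every `m`-fragile graph admits an `m`-colouring using exactly two colours on any three
given distinct vertices that are not all pairwise adjacent. -/
theorem statement6 {V : Type*} [Fintype V] (G : SimpleGraph V) (m : ℕ) (hm : 4 ≤ m)
    (hG : G.MFragile m) (x y z : V) (hxy : x ≠ y) (hxz : x ≠ z) (hyz : y ≠ z)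
    (hnotall : ¬ (G.Adj x y ∧ G.Adj y z ∧ G.Adj x z)) :
    ∃ c : V → ℕ, (∀ v, c v ∈ Finset.Icc 1 m) ∧ (∀ u v, G.Adj u v → c u ≠ c v) ∧
      ({c x, c y, c z} : Finset ℕ).card = 2 := by
  obtain ⟨c, hc, hnot, htwo⟩ := (FragileColouring.flexible hm hG Finset.univ).two x
    (Finset.mem_univ x) y (Finset.mem_univ y) z (Finset.mem_univ z) hxy hxz hyz hnotall
  have hinj : ∀ u v, (c u : ℕ) + 1 = c v + 1 ↔ c u = c v := fun u v => by
    rw [Nat.add_right_cancel_iff, Fin.val_inj]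
  refine ⟨fun v => c v + 1, fun v => ?_, fun u v e => ?_, ?_⟩
  · have := (c v).isLt
    simp only [Finset.mem_Icc]
    omega
  · exact fun h => hc u (Finset.mem_univ u) v (Finset.mem_univ v) e ((hinj u v).mp h)
  · rw [Finset.card_eq_two]
    by_cases h : c x = c y
    · have h' : c x ≠ c z := by grind
      exact ⟨c x + 1, c z + 1, by rwa [Ne, hinj], by simp [h]⟩
    · refine ⟨c x + 1, c y + 1, by rwa [Ne, hinj], ?_⟩
      rcases htwo with e | e | e
      · exact absurd e h
      · simp [e]
      · ext n
        simp [e]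
        tauto
end
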